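/- arXiv:2012.15528 — 2 statements merged into one kernel-verified Lean document; each statement's English description precedes it below -/
import Mathlib

section
/- Let (F_p)_{p∈P} be a family of C^r-skew-products satisfying assumption (U). For every p ∈ P' and 𝔞 ∈ 𝒜^ℕ, the limit Π_{p,𝔞}(s) = lim_{n→∞} (1/n) log Σ_{α∈𝒜^n} M(Dψ^α_{p,𝔞})^s exists and is finite for every s ≥ 0; the map s ∈ ℝ₊ ↦ Π_{p,𝔞}(s) is strictly decreasing and continuous, is independent of 𝔞, satisfies Π_{p,𝔞}(0) > 0 and lim_{s→+∞} Π_{p,𝔞}(s) = −∞. Consequently it has exactly one zero Δ(p), and the map p ↦ Δ(p) is continuous. -/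
open Filter MeasureTheory Set
open scoped Topology ENNReal NNReal

noncomputable section

namespace Paper

abbrev E (n : ℕ) : Type := EuclideanSpace ℝ (Fin n)

def cube (N : ℕ) : Set (E N) := {x | ∀ i, x i ∈ Icc (-1:ℝ) 1}

def cubeO (d : ℕ) : Set (E d) := {p | ∀ i, p i ∈ Ioo (-1:ℝ) 1}

variable {A : Type}

def consF (a : A) (𝔞 : ℕ → A) : ℕ → A := fun n =>
  match n with
  | 0 => a
  | Nat.succ k => 𝔞 k

def app : List A → (ℕ → A) → ℕ → A
  | [], 𝔞 => 𝔞
  | a :: w, 𝔞 => app w (consF a 𝔞)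

def trunc (α : ℕ → A) (n : ℕ) : List A := List.ofFn fun i : Fin n => α i

def cyl (w : List A) : Set (ℕ → A) := {α | ∀ i : Fin w.length, α i = w.get i}

variable {N d : ℕ}

def psi (f : E d → (ℕ → A) → E N → E N) (p : E d) : List A → (ℕ → A) → E N → E N
  | [], _ => id
  | a :: w, 𝔞 => f p (consF a 𝔞) ∘ psi f p w (consF a 𝔞)

def dentry (g : E N → E N) (x : E N) (i j : Fin N) : ℝ :=
  fderiv ℝ g x (EuclideanSpace.single j (1:ℝ)) i

def lam (hN : 0 < N) (f : E d → (ℕ → A) → E N → E N) (p : E d) (𝔞 : ℕ → A)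
    (w : List A) (x : E N) : ℝ :=
  |dentry (psi f p w 𝔞) x ⟨0, hN⟩ ⟨0, hN⟩|

def Lam (hN : 0 < N) (f : E d → (ℕ → A) → E N → E N) (p : E d) (𝔞 : ℕ → A)
    (w : List A) : ℝ :=
  sSup ((fun x => lam hN f p 𝔞 w x) '' cube N)

def piProj (f : E d → (ℕ → A) → E N → E N) (p : E d) (𝔞 α : ℕ → A) : E N :=
  limUnder atTop fun n => psi f p (trunc α n) 𝔞 0

def Mop (g : E N → E N) : ℝ := sSup ((fun x => ‖fderiv ℝ g x‖) '' cube N)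

def pressure [Fintype A] (f : E d → (ℕ → A) → E N → E N) (p : E d) (𝔞 : ℕ → A) (s : ℝ) : ℝ :=
  limUnder atTop fun n : ℕ =>
    (1 / n : ℝ) * Real.log (∑ w : Fin n → A, Mop (psi f p (List.ofFn w) 𝔞) ^ s)

structure SkewFamily (A : Type) (N d : ℕ) (r : ℕ∞) where
  f : E d → (ℕ → A) → E N → E N
  X' : Set (E N)
  P' : Set (E d)
  X'_open : IsOpen X'
  X_subset : cube N ⊆ X'
  P'_open : IsOpen P'
  P_subset : closure (cubeO d) ⊆ P'
  smooth : ∀ 𝔞 : ℕ → A, ContDiffOn ℝ r (fun q : E d × E N => f q.1 𝔞 q.2) (P' ×ˢ X')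
  inj : ∀ 𝔞 : ℕ → A, ∀ p ∈ P', Set.InjOn (f p 𝔞) X'
  into : ∀ 𝔞 : ℕ → A, ∀ p ∈ P', f p 𝔞 '' X' ⊆ cube N
  holder0 : ∃ C > (0:ℝ), ∃ θ ∈ Set.Ioo (0:ℝ) 1, ∀ p ∈ P', ∀ (𝔞 𝔟 : ℕ → A) (q : ℕ),
      (∀ i < q, 𝔞 i = 𝔟 i) → ∀ x ∈ X', ‖f p 𝔞 x - f p 𝔟 x‖ ≤ C * θ ^ q
  holder1 : ∃ C > (0:ℝ), ∃ θ ∈ Set.Ioo (0:ℝ) 1, ∀ p ∈ P', ∀ (𝔞 𝔟 : ℕ → A) (q : ℕ),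
      (∀ i < q, 𝔞 i = 𝔟 i) → ∀ x ∈ X',
      ‖fderiv ℝ (f p 𝔞) x - fderiv ℝ (f p 𝔟) x‖ ≤ C * θ ^ q
  cont2 : ∀ p ∈ P', ∀ 𝔞 : ℕ → A, ∀ ε > (0:ℝ), ∃ q : ℕ, ∀ 𝔟 : ℕ → A,
      (∀ i < q, 𝔞 i = 𝔟 i) → ∀ x ∈ X',
      ‖iteratedFDeriv ℝ 2 (f p 𝔞) x - iteratedFDeriv ℝ 2 (f p 𝔟) x‖ ≤ ε

def UnipOn (hN : 0 < N) (f : E d → (ℕ → A) → E N → E N)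
    (P' : Set (E d)) (X' : Set (E N)) : Prop :=
  ∀ p ∈ P', ∀ 𝔞 : ℕ → A, ∀ x ∈ X',
    (∀ i j : Fin N, (i : ℕ) < (j : ℕ) → dentry (f p 𝔞) x i j = 0) ∧
    (∀ i j : Fin N, dentry (f p 𝔞) x i i = dentry (f p 𝔞) x j j) ∧
    0 < |dentry (f p 𝔞) x ⟨0, hN⟩ ⟨0, hN⟩| ∧ |dentry (f p 𝔞) x ⟨0, hN⟩ ⟨0, hN⟩| < 1

def GammaBounds (hN : 0 < N) (f : E d → (ℕ → A) → E N → E N) (γ' γ : ℝ) : Prop :=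
  0 < γ' ∧ γ' < γ ∧ γ < 1 ∧
  ∀ p ∈ closure (cubeO d), ∀ (𝔞 : ℕ → A) (a : A), ∀ x ∈ cube N,
    γ' < lam hN f p 𝔞 [a] x ∧ lam hN f p 𝔞 [a] x < γ

structure ParamPerturb {A : Type} {N d : ℕ} {r : ℕ∞} (hN : 0 < N)
    (S : SkewFamily A N d r) (θ : ℝ) (τ : ℕ) where
  g : E τ → E d → (ℕ → A) → E N → E N
  jointSmooth : ∀ 𝔞 : ℕ → A, ContDiffOn ℝ r
      (fun q : E τ × E d × E N => g q.1 q.2.1 𝔞 q.2.2) ((cubeO τ) ×ˢ S.P' ×ˢ S.X')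
  smooth : ∀ t ∈ cubeO τ, ∀ 𝔞 : ℕ → A, ContDiffOn ℝ r
      (fun q : E d × E N => g t q.1 𝔞 q.2) (S.P' ×ˢ S.X')
  inj : ∀ t ∈ cubeO τ, ∀ 𝔞 : ℕ → A, ∀ p ∈ S.P', Set.InjOn (g t p 𝔞) S.X'
  into : ∀ t ∈ cubeO τ, ∀ 𝔞 : ℕ → A, ∀ p ∈ S.P', g t p 𝔞 '' S.X' ⊆ cube N
  close : ∃ θ' < θ, ∀ t ∈ cubeO τ, ∀ (𝔞 : ℕ → A) (k : ℕ), (k : ℕ∞) ≤ r →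
      ∀ p ∈ S.P', ∀ x ∈ S.X',
      ‖iteratedFDeriv ℝ k (fun q : E d × E N => S.f q.1 𝔞 q.2 - g t q.1 𝔞 q.2) (p, x)‖ ≤ θ'
  unip : ∀ t ∈ cubeO τ, UnipOn hN (g t) S.P' S.X'

def TransAssumption {A : Type} {N d : ℕ} {r : ℕ∞} (hN : 0 < N)
    (S : SkewFamily A N d r) : Prop :=
  ∃ C > (0:ℝ),
    (∀ 𝔞 α β : ℕ → A, α 0 ≠ β 0 → ∀ rr > (0:ℝ),
      volume {p ∈ cubeO d | ‖piProj S.f p 𝔞 α - piProj S.f p 𝔞 β‖ < rr}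
        ≤ ENNReal.ofReal (C * rr ^ N)) ∧
    ∃ θ₀ > (0:ℝ), ∀ θ : ℝ, 0 < θ → θ ≤ θ₀ → ∀ τ : ℕ, 0 < τ →
      ∀ Ft : ParamPerturb hN S θ τ, ∀ t ∈ cubeO τ,
      ∀ 𝔞 α β : ℕ → A, α 0 ≠ β 0 → ∀ rr > (0:ℝ),
        volume {p ∈ cubeO d | ‖piProj (Ft.g t) p 𝔞 α - piProj (Ft.g t) p 𝔞 β‖ < rr}
          ≤ ENNReal.ofReal (C * rr ^ N)

def dens {N : ℕ} (ν : Measure (E N)) (x : E N) : ℝ≥0∞ :=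
  liminf (fun rr : ℝ => ν (Metric.ball x rr) / volume (Metric.ball (0 : E N) rr)) (𝓝[>] (0:ℝ))

end Paper

namespace IFS

open Paper

variable {A : Type}

def psiA (c b : ℝ → A → ℝ) (p : ℝ) : List A → ℝ → ℝ
  | [], x => x
  | a :: w, x => c p a * psiA c b p w x + b p a

def piA (c b : ℝ → A → ℝ) (p : ℝ) (α : ℕ → A) : ℝ :=
  limUnder atTop fun n => psiA c b p (Paper.trunc α n) 0

def LamA (c : ℝ → A → ℝ) (p : ℝ) (w : List A) : ℝ := (w.map fun a => |c p a|).prod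

def IFSHyp (c b : ℝ → A → ℝ) (U : Set ℝ) : Prop :=
  IsOpen U ∧ Icc (-1:ℝ) 1 ⊆ U ∧
  (∀ a : A, ContinuousOn (fun p => c p a) U) ∧
  (∀ a : A, ContinuousOn (fun p => b p a) U) ∧
  (∀ p ∈ U, ∀ a : A, ∀ x ∈ Icc (-1:ℝ) 1, c p a * x + b p a ∈ Ioo (-1:ℝ) 1)

def GammaBoundsA (c : ℝ → A → ℝ) (γ' γ : ℝ) : Prop :=
  0 < γ' ∧ γ' < γ ∧ γ < 1 ∧ ∀ p ∈ Icc (-1:ℝ) 1, ∀ a : A, γ' < |c p a| ∧ |c p a| < γ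

def TransAff (c b : ℝ → A → ℝ) : Prop :=
  ∃ C > (0:ℝ), ∀ α β : ℕ → A, α 0 ≠ β 0 → ∀ rr > (0:ℝ),
    volume {p ∈ Ioo (-1:ℝ) 1 | |piA c b p α - piA c b p β| < rr} ≤ ENNReal.ofReal (C * rr)

def densR (ν : MeasureTheory.Measure ℝ) (x : ℝ) : ℝ≥0∞ :=
  liminf (fun rr : ℝ => ν (Ioo (x - rr) (x + rr)) / ENNReal.ofReal (2 * rr)) (𝓝[>] (0:ℝ))

end IFS

namespace Paper

section LinAlg

lemma op_le_entries {N : ℕ} (B : E N →L[ℝ] E N) (b : ℝ)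
    (h : ∀ i j, |B (EuclideanSpace.single j (1:ℝ)) i| ≤ b) : ‖B‖ ≤ N * N * b := by
  rcases Nat.eq_zero_or_pos N with h0 | h0
  · subst h0
    refine ContinuousLinearMap.opNorm_le_bound _ (by simp) fun v => ?_
    have : B v = 0 := Subsingleton.elim _ _
    simp [this]
  have hb : 0 ≤ b := le_trans (abs_nonneg _) (h ⟨0, h0⟩ ⟨0, h0⟩)
  have l1 : ∀ v : E N, ‖v‖ ≤ ∑ i, |v i| := by
    intro v
    have e : v = ∑ i, v i • EuclideanSpace.single i (1:ℝ) := by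
      ext k
      simp [Pi.single_apply]
    calc ‖v‖ = ‖∑ i, v i • EuclideanSpace.single i (1:ℝ)‖ := by rw [← e]
      _ ≤ ∑ i, ‖v i • EuclideanSpace.single i (1:ℝ)‖ := norm_sum_le _ _
      _ = _ := by simp [norm_smul]
  refine ContinuousLinearMap.opNorm_le_bound _ (by positivity) fun v => ?_
  have e : v = ∑ i, v i • EuclideanSpace.single i (1:ℝ) := by
    ext k
    simp [Pi.single_apply]
  have e2 : ∀ i, |B v i| ≤ N * (b * ‖v‖) := by
    intro i
    have : B v i = ∑ j, v j * B (EuclideanSpace.single j (1:ℝ)) i := by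
      conv_lhs => rw [e]
      simp [map_sum]
    rw [this]
    calc |∑ j, v j * B (EuclideanSpace.single j (1:ℝ)) i|
        ≤ ∑ j, |v j * B (EuclideanSpace.single j (1:ℝ)) i| := Finset.abs_sum_le_sum_abs _ _
      _ ≤ ∑ j : Fin N, b * ‖v‖ := by
          refine Finset.sum_le_sum fun j _ => ?_
          rw [abs_mul, mul_comm]
          have : |v j| ≤ ‖v‖ := by simpa using PiLp.norm_apply_le v j
          exact mul_le_mul (h i j) this (abs_nonneg _) hb
      _ = _ := by simp
  calc ‖B v‖ ≤ ∑ i, |B v i| := l1 _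
    _ ≤ ∑ i : Fin N, N * (b * ‖v‖) := Finset.sum_le_sum fun i _ => e2 i
    _ = _ := by simp; ring

lemma entry_le {N : ℕ} (B : E N →L[ℝ] E N) (i j : Fin N) :
    |B (EuclideanSpace.single j (1:ℝ)) i| ≤ ‖B‖ := by
  have h1 : |B (EuclideanSpace.single j (1:ℝ)) i| ≤ ‖B (EuclideanSpace.single j (1:ℝ))‖ := by
    simpa using PiLp.norm_apply_le (B (EuclideanSpace.single j (1:ℝ))) i
  refine h1.trans ?_
  simpa using B.le_opNorm (EuclideanSpace.single j (1:ℝ))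

def diagC (N : ℕ) (t : ℕ → ℝ) : E N →L[ℝ] E N :=
  LinearMap.toContinuousLinearMap
    { toFun := fun v => WithLp.toLp 2 fun i : Fin N => t i * v i
      map_add' := by intro u v; ext i; simp [mul_add]
      map_smul' := by intro u v; ext i; simp [mul_left_comm] }

lemma diagC_apply {N : ℕ} (t : ℕ → ℝ) (v : E N) (i : Fin N) : diagC N t v i = t i * v i := rfl

/-- adapted norm -/
lemma exists_adapted {N : ℕ} (hN : 0 < N) (L ε : ℝ) (hε : 0 < ε) :
    ∃ T T' : E N →L[ℝ] E N, (∀ v, T' (T v) = v) ∧ (∀ v, T (T' v) = v) ∧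
      ∀ B : E N →L[ℝ] E N, ‖B‖ ≤ L →
        (∀ i j : Fin N, (i : ℕ) < (j : ℕ) → B (EuclideanSpace.single j (1:ℝ)) i = 0) →
        (∀ i j : Fin N, B (EuclideanSpace.single i (1:ℝ)) i = B (EuclideanSpace.single j (1:ℝ)) j) →
        ‖T.comp (B.comp T')‖ ≤ |B (EuclideanSpace.single ⟨0, hN⟩ (1:ℝ)) ⟨0, hN⟩| + ε := by
  set t : ℝ := min 1 (ε / (N * N * (|L| + 1))) with ht
  have hN' : (0:ℝ) < N := by exact_mod_cast hN
  have hL : 0 < |L| + 1 := by positivity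
  have t0 : 0 < t := by rw [ht]; positivity
  have t1 : t ≤ 1 := min_le_left _ _
  have t2 : N * N * (t * (|L| + 1)) ≤ ε := by
    have : t ≤ ε / (N * N * (|L| + 1)) := min_le_right _ _
    rw [le_div_iff₀ (by positivity)] at this
    linarith
  refine ⟨diagC N fun i => t ^ i, diagC N fun i => (t ^ i)⁻¹, ?_, ?_, ?_⟩
  · intro v; ext i; simp [diagC_apply, t0.ne']
  · intro v; ext i; simp [diagC_apply, t0.ne']
  intro B hB h1 h2
  set l := B (EuclideanSpace.single ⟨0, hN⟩ (1:ℝ)) ⟨0, hN⟩ with hl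
  set T := diagC N fun i => t ^ i
  set T' := diagC N fun i => (t ^ i)⁻¹
  have key : ‖T.comp (B.comp T') - l • ContinuousLinearMap.id ℝ (E N)‖ ≤ N * N * (t * (|L|+1)) := by
    apply op_le_entries
    intro i j
    have hT' : T' (EuclideanSpace.single j (1:ℝ)) = (t ^ (j:ℕ))⁻¹ • EuclideanSpace.single j (1:ℝ) := by
      ext k
      simp only [T', diagC_apply, PiLp.smul_apply, smul_eq_mul]
      by_cases hk : k = j
      · subst hk; simp
      · simp [hk]
    have e : (T.comp (B.comp T') - l • ContinuousLinearMap.id ℝ (E N))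
        (EuclideanSpace.single j (1:ℝ)) i
        = t ^ (i:ℕ) * ((t ^ (j:ℕ))⁻¹ * B (EuclideanSpace.single j (1:ℝ)) i)
          - l * (EuclideanSpace.single j (1:ℝ) : E N) i := by
      simp only [_root_.sub_apply, ContinuousLinearMap.comp_apply, hT', map_smul]
      simp [T, diagC_apply]
      ring
    rw [e]
    rcases lt_trichotomy (i:ℕ) (j:ℕ) with hij | hij | hij
    · have hne : i ≠ j := fun h => by subst h; exact lt_irrefl _ hij
      rw [h1 i j hij]
      simp [hne]
      positivity
    · have : i = j := Fin.ext hij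
      subst this
      have := h2 i ⟨0, hN⟩
      rw [this, ← hl]
      have h3 : t ^ (i:ℕ) ≠ 0 := by positivity
      rw [mul_inv_cancel_left₀ h3]
      simp
      positivity
    · have hne : i ≠ j := fun h => by subst h; exact lt_irrefl _ hij
      obtain ⟨k, hk⟩ : ∃ k, (i:ℕ) = j + (k + 1) := ⟨i - j - 1, by omega⟩
      have h3 : t ^ (j:ℕ) ≠ 0 := by positivity
      have : t ^ (i:ℕ) * ((t ^ (j:ℕ))⁻¹ * B (EuclideanSpace.single j (1:ℝ)) i)
        = t ^ (k+1) * B (EuclideanSpace.single j (1:ℝ)) i := by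
        rw [hk, pow_add]; field_simp
      rw [this]
      simp only [PiLp.single_apply, hne, if_false, mul_zero, sub_zero]
      rw [abs_mul, abs_of_pos (by positivity)]
      have h4 : t ^ (k+1) ≤ t := by
        rw [pow_succ]; exact mul_le_of_le_one_left t0.le (pow_le_one₀ t0.le t1)
      have h5 := entry_le B i j
      have h6 : |B (EuclideanSpace.single j (1:ℝ)) i| ≤ |L| + 1 := by
        have := le_abs_self L; linarith
      exact mul_le_mul h4 h6 (abs_nonneg _) t0.le
  calc ‖T.comp (B.comp T')‖ = ‖l • ContinuousLinearMap.id ℝ (E N) + (T.comp (B.comp T') - l • ContinuousLinearMap.id ℝ (E N))‖ := by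
        congr 1; abel
    _ ≤ ‖l • ContinuousLinearMap.id ℝ (E N)‖ + _ := norm_add_le _ _
    _ ≤ |l| + ε := by
        refine add_le_add ?_ (key.trans t2)
        rw [norm_smul]
        have : ‖ContinuousLinearMap.id ℝ (E N)‖ ≤ 1 := ContinuousLinearMap.norm_id_le
        calc _ ≤ ‖l‖ * 1 := by gcongr
          _ = |l| := by simp

end LinAlg

section Compact

lemma exists_unif {A : Type} [Fintype A] {Pr : ℝ → (ℕ → A) → Prop}
    (mono : ∀ c c' 𝔟, 0 < c' → c' ≤ c → Pr c 𝔟 → Pr c' 𝔟)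
    (h : ∀ 𝔞 : ℕ → A, ∃ q : ℕ, ∃ c > 0, ∀ 𝔟, (∀ i < q, 𝔞 i = 𝔟 i) → Pr c 𝔟) :
    ∃ c > 0, ∀ 𝔟, Pr c 𝔟 := by
  let _ : TopologicalSpace A := ⊥
  have : DiscreteTopology A := ⟨rfl⟩
  have := (isCompact_univ (X := ℕ → A)).induction_on
    (p := fun s => ∃ c > 0, ∀ 𝔟 ∈ s, Pr c 𝔟) ⟨1, one_pos, by simp⟩
    (fun s t hst ⟨c, hc, H⟩ => ⟨c, hc, fun b hb => H b (hst hb)⟩)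
    (fun s t ⟨c, hc, H⟩ ⟨c', hc', H'⟩ => ⟨min c c', lt_min hc hc', fun b hb => by
      rcases hb with hb | hb
      · exact mono _ _ _ (lt_min hc hc') (min_le_left _ _) (H b hb)
      · exact mono _ _ _ (lt_min hc hc') (min_le_right _ _) (H' b hb)⟩)
    (fun 𝔞 _ => by
      obtain ⟨q, c, hc, H⟩ := h 𝔞
      refine ⟨{𝔟 | ∀ i < q, 𝔞 i = 𝔟 i}, ?_, c, hc, fun b hb => H b hb⟩
      apply mem_nhdsWithin_of_mem_nhds
      have : {𝔟 : ℕ → A | ∀ i < q, 𝔞 i = 𝔟 i} = Set.pi (Set.Iio q) fun i => {𝔞 i} := by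
        ext b; simp [Set.mem_pi, eq_comm]
      rw [this]
      exact set_pi_mem_nhds (Set.finite_Iio q) fun i _ => by simp)
  obtain ⟨c, hc, H⟩ := this
  exact ⟨c, hc, fun b => H b trivial⟩

variable {A : Type} [Fintype A] {Y Z : Type} [PseudoMetricSpace Y] [PseudoMetricSpace Z]

lemma exists_uc {K : Set Y} (hK : IsCompact K) (Φ : (ℕ → A) → Y → Z)
    (hc : ∀ 𝔞, ContinuousOn (Φ 𝔞) K)
    (hq : ∀ ε > (0:ℝ), ∃ q : ℕ, ∀ 𝔞 𝔟 : ℕ → A, (∀ i < q, 𝔞 i = 𝔟 i) →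
      ∀ y ∈ K, dist (Φ 𝔞 y) (Φ 𝔟 y) ≤ ε) (ε : ℝ) (hε : 0 < ε) :
    ∃ η > 0, ∃ Q : ℕ, ∀ 𝔞 𝔟 : ℕ → A, (∀ i < Q, 𝔞 i = 𝔟 i) → ∀ x ∈ K, ∀ y ∈ K,
      dist x y < η → dist (Φ 𝔞 x) (Φ 𝔟 y) ≤ ε := by
  obtain ⟨q, hq1⟩ := hq (ε/4) (by positivity)
  obtain ⟨η, hη, H⟩ := exists_unif (A := A) (Pr := fun η 𝔟 => ∀ x ∈ K, ∀ y ∈ K, dist x y < η →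
      dist (Φ 𝔟 x) (Φ 𝔟 y) ≤ 3 * ε / 4)
    (fun c c' b _ h1 h2 x hx y hy hxy => h2 x hx y hy (hxy.trans_le h1))
    (fun 𝔞 => by
      have := hK.uniformContinuousOn_of_continuous (hc 𝔞)
      obtain ⟨η, hη, H⟩ := Metric.uniformContinuousOn_iff.1 this (ε/4) (by positivity)
      refine ⟨q, η, hη, fun 𝔟 hb x hx y hy hxy => ?_⟩
      have h1 := hq1 𝔞 𝔟 hb x hx
      have h2 := hq1 𝔞 𝔟 hb y hy
      have h3 := H x hx y hy hxy
      have h4 := dist_triangle4 (Φ 𝔟 x) (Φ 𝔞 x) (Φ 𝔞 y) (Φ 𝔟 y)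
      rw [dist_comm (Φ 𝔟 x) (Φ 𝔞 x)] at h4
      linarith)
  refine ⟨η, hη, q, fun 𝔞 𝔟 hab x hx y hy hxy => ?_⟩
  have h1 := hq1 𝔞 𝔟 hab x hx
  have h2 := H 𝔟 x hx y hy hxy
  have h3 := dist_triangle (Φ 𝔞 x) (Φ 𝔟 x) (Φ 𝔟 y)
  linarith

lemma exists_lb {K : Set Y} (hK : IsCompact K) (Φ : (ℕ → A) → Y → ℝ)
    (hc : ∀ 𝔞, ContinuousOn (Φ 𝔞) K)
    (hq : ∀ ε > (0:ℝ), ∃ q : ℕ, ∀ 𝔞 𝔟 : ℕ → A, (∀ i < q, 𝔞 i = 𝔟 i) →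
      ∀ y ∈ K, dist (Φ 𝔞 y) (Φ 𝔟 y) ≤ ε) (hpos : ∀ 𝔞, ∀ y ∈ K, 0 < Φ 𝔞 y) :
    ∃ c > 0, ∀ 𝔞, ∀ y ∈ K, c ≤ Φ 𝔞 y := by
  refine exists_unif (A := A) (Pr := fun c 𝔟 => ∀ y ∈ K, c ≤ Φ 𝔟 y)
    (fun c c' b _ h1 h2 x hx => h1.trans (h2 x hx)) fun 𝔞 => ?_
  rcases K.eq_empty_or_nonempty with h0 | h0
  · exact ⟨0, 1, one_pos, by simp [h0]⟩
  obtain ⟨x, hx, hm⟩ := hK.exists_isMinOn h0 (hc 𝔞)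
  obtain ⟨q, hq1⟩ := hq (Φ 𝔞 x / 2) (by have := hpos 𝔞 x hx; positivity)
  refine ⟨q, Φ 𝔞 x / 2, by have := hpos 𝔞 x hx; positivity, fun 𝔟 hb y hy => ?_⟩
  have h1 := hq1 𝔞 𝔟 hb y hy
  have h2 : Φ 𝔞 x ≤ Φ 𝔞 y := hm hy
  rw [Real.dist_eq] at h1
  have := (abs_le.1 h1).2
  linarith

end Compact

section Dyn

lemma cube_compact (N : ℕ) : IsCompact (cube N) := by
  have h : IsCompact (Set.pi Set.univ fun _ : Fin N => Icc (-1:ℝ) 1) :=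
    isCompact_univ_pi fun _ => isCompact_Icc
  have := (EuclideanSpace.equiv (Fin N) ℝ).toHomeomorph.isCompact_preimage.2 h
  convert this using 1
  ext x
  exact ⟨fun h i _ => h i, fun h i => h i trivial⟩

lemma cube_convex (N : ℕ) : Convex ℝ (cube N) := by
  intro x hx y hy a b ha hb hab i
  have := convex_Icc (-1:ℝ) 1 (hx i) (hy i) ha hb hab
  simpa using this

lemma zero_mem_cube (N : ℕ) : (0 : E N) ∈ cube N := by
  intro i; simp

/-- collected regularity data on a set of parameters -/
structure Good {A : Type} {N d : ℕ} (hN : 0 < N) (f : E d → (ℕ → A) → E N → E N) (V : Set (E d))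
    (c g2 L C θ : ℝ) : Prop where
  diff : ∀ p ∈ V, ∀ 𝔞, ∀ x ∈ cube N, DifferentiableAt ℝ (f p 𝔞) x
  maps : ∀ p ∈ V, ∀ 𝔞, ∀ x ∈ cube N, f p 𝔞 x ∈ cube N
  tri : ∀ p ∈ V, ∀ 𝔞, ∀ x ∈ cube N, ∀ i j : Fin N, (i : ℕ) < (j : ℕ) → dentry (f p 𝔞) x i j = 0
  deq : ∀ p ∈ V, ∀ 𝔞, ∀ x ∈ cube N, ∀ i j : Fin N, dentry (f p 𝔞) x i i = dentry (f p 𝔞) x j j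
  c_pos : 0 < c
  g2_lt : g2 < 1
  lb : ∀ p ∈ V, ∀ 𝔞, ∀ x ∈ cube N, c ≤ |dentry (f p 𝔞) x ⟨0, hN⟩ ⟨0, hN⟩|
  ub : ∀ p ∈ V, ∀ 𝔞, ∀ x ∈ cube N, |dentry (f p 𝔞) x ⟨0, hN⟩ ⟨0, hN⟩| ≤ g2
  nb : ∀ p ∈ V, ∀ 𝔞, ∀ x ∈ cube N, ‖fderiv ℝ (f p 𝔞) x‖ ≤ L
  C_pos : 0 < C
  θ_pos : 0 < θ
  θ_lt : θ < 1
  hol : ∀ p ∈ V, ∀ (𝔞 𝔟 : ℕ → A) (q : ℕ), (∀ i < q, 𝔞 i = 𝔟 i) →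
    ∀ x ∈ cube N, ‖f p 𝔞 x - f p 𝔟 x‖ ≤ C * θ ^ q
  ucf : ∀ ε > (0:ℝ), ∃ η > 0, ∀ p ∈ V, ∀ q ∈ V, dist p q < η → ∀ 𝔞, ∀ x ∈ cube N,
    ‖f p 𝔞 x - f q 𝔞 x‖ ≤ ε
  ucg : ∀ ε > (0:ℝ), ∃ η > 0, ∃ Q : ℕ, ∀ p ∈ V, ∀ q ∈ V, dist p q < η →
    ∀ 𝔞 𝔟 : ℕ → A, (∀ i < Q, 𝔞 i = 𝔟 i) → ∀ x ∈ cube N, ∀ y ∈ cube N, dist x y < η →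
    |(|dentry (f p 𝔞) x ⟨0, hN⟩ ⟨0, hN⟩| - |dentry (f q 𝔟) y ⟨0, hN⟩ ⟨0, hN⟩|)| ≤ ε

variable {A : Type} {N d : ℕ} {hN : 0 < N} {f : E d → (ℕ → A) → E N → E N} {V : Set (E d)}
  {c g2 L C θ : ℝ}

def lamP (hN : 0 < N) (f : E d → (ℕ → A) → E N → E N) (p : E d) :
    List A → (ℕ → A) → E N → ℝ
  | [], _, _ => 1
  | a :: w, 𝔞, x => |dentry (f p (consF a 𝔞)) (psi f p w (consF a 𝔞) x) ⟨0, hN⟩ ⟨0, hN⟩|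
      * lamP hN f p w (consF a 𝔞) x

namespace Good

lemma psi_mem (H : Good hN f V c g2 L C θ) {p : E d} (hp : p ∈ V) (w : List A) (𝔞 : ℕ → A)
    {x : E N} (hx : x ∈ cube N) : psi f p w 𝔞 x ∈ cube N := by
  induction w generalizing 𝔞 with
  | nil => exact hx
  | cons a w ih => exact H.maps p hp _ _ (ih _)

lemma psi_diff (H : Good hN f V c g2 L C θ) {p : E d} (hp : p ∈ V) (w : List A) (𝔞 : ℕ → A)
    {x : E N} (hx : x ∈ cube N) : DifferentiableAt ℝ (psi f p w 𝔞) x := by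
  induction w generalizing 𝔞 with
  | nil => exact differentiableAt_id
  | cons a w ih => exact (H.diff p hp _ _ (H.psi_mem hp w _ hx)).comp x (ih _)

lemma fderiv_cons (H : Good hN f V c g2 L C θ) {p : E d} (hp : p ∈ V) (a : A) (w : List A)
    (𝔞 : ℕ → A) {x : E N} (hx : x ∈ cube N) :
    fderiv ℝ (psi f p (a :: w) 𝔞) x =
      (fderiv ℝ (f p (consF a 𝔞)) (psi f p w (consF a 𝔞) x)).comp
        (fderiv ℝ (psi f p w (consF a 𝔞)) x) :=
  fderiv_comp x (H.diff p hp _ _ (H.psi_mem hp w _ hx)) (H.psi_diff hp w _ hx)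

lemma lamP_bounds (H : Good hN f V c g2 L C θ) {p : E d} (hp : p ∈ V) (w : List A)
    (𝔞 : ℕ → A) {x : E N} (hx : x ∈ cube N) :
    c ^ w.length ≤ lamP hN f p w 𝔞 x ∧ lamP hN f p w 𝔞 x ≤ g2 ^ w.length := by
  have hc := H.c_pos
  induction w generalizing 𝔞 with
  | nil => simp [lamP]
  | cons a w ih =>
    have h1 := ih (consF a 𝔞)
    have h2 := H.lb p hp (consF a 𝔞) _ (H.psi_mem hp w (consF a 𝔞) hx)
    have h3 := H.ub p hp (consF a 𝔞) _ (H.psi_mem hp w (consF a 𝔞) hx)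
    simp only [lamP, List.length_cons, pow_succ']
    constructor
    · exact mul_le_mul h2 h1.1 (by positivity) (abs_nonneg _)
    · exact mul_le_mul h3 h1.2 (le_trans (by positivity) h1.1) ((abs_nonneg _).trans h3)

lemma lamP_pos (H : Good hN f V c g2 L C θ) {p : E d} (hp : p ∈ V) (w : List A)
    (𝔞 : ℕ → A) {x : E N} (hx : x ∈ cube N) : 0 < lamP hN f p w 𝔞 x :=
  lt_of_lt_of_le (pow_pos H.c_pos _) (H.lamP_bounds hp w 𝔞 hx).1

lemma lamP_le_norm (H : Good hN f V c g2 L C θ) {p : E d} (hp : p ∈ V) (w : List A)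
    (𝔞 : ℕ → A) {x : E N} (hx : x ∈ cube N) :
    lamP hN f p w 𝔞 x ≤ ‖fderiv ℝ (psi f p w 𝔞) x‖ := by
  let l : Fin N := ⟨N - 1, by omega⟩
  have key : ∃ k : ℝ, |k| = lamP hN f p w 𝔞 x ∧
      fderiv ℝ (psi f p w 𝔞) x (EuclideanSpace.single l (1:ℝ)) = k • EuclideanSpace.single l (1:ℝ) := by
    induction w generalizing 𝔞 with
    | nil => exact ⟨1, by simp [lamP], by simp [psi]⟩
    | cons a w ih =>
      obtain ⟨k, h1, h2⟩ := ih (consF a 𝔞)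
      have hm := H.psi_mem hp w (consF a 𝔞) hx
      have e : fderiv ℝ (f p (consF a 𝔞)) (psi f p w (consF a 𝔞) x) (EuclideanSpace.single l (1:ℝ))
          = dentry (f p (consF a 𝔞)) (psi f p w (consF a 𝔞) x) ⟨0, hN⟩ ⟨0, hN⟩ •
            EuclideanSpace.single l (1:ℝ) := by
        ext i
        by_cases hi : i = l
        · subst hi
          have := H.deq p hp (consF a 𝔞) _ hm l ⟨0, hN⟩
          rw [← this]
          simp [dentry]
        · have : (i:ℕ) < (l:ℕ) := by
            have h3 : (i:ℕ) ≠ l := fun h => hi (Fin.ext h)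
            have := i.2
            simp only [l] at h3 ⊢
            omega
          have := H.tri p hp (consF a 𝔞) _ hm i l this
          simp only [dentry] at this
          rw [this]
          simp [hi]
      refine ⟨k * dentry (f p (consF a 𝔞)) (psi f p w (consF a 𝔞) x) ⟨0, hN⟩ ⟨0, hN⟩, ?_, ?_⟩
      · rw [abs_mul, h1, mul_comm]; rfl
      · rw [H.fderiv_cons hp a w 𝔞 hx, ContinuousLinearMap.comp_apply, h2, map_smul, e, smul_smul]
  obtain ⟨k, h1, h2⟩ := key
  have := (fderiv ℝ (psi f p w 𝔞) x).le_opNorm (EuclideanSpace.single l (1:ℝ))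
  rw [h2, norm_smul] at this
  simpa [h1] using this

lemma g2_nonneg (H : Good hN f V c g2 L C θ) {p : E d} (hp : p ∈ V) (𝔞 : ℕ → A) : 0 < g2 :=
  H.c_pos.trans_le ((H.lb p hp 𝔞 0 (zero_mem_cube N)).trans (H.ub p hp 𝔞 0 (zero_mem_cube N)))

/-- adapted norm for the family -/
lemma adapted (H : Good hN f V c g2 L C θ) (δ : ℝ) (hδ : 0 < δ) :
    ∃ T T' : E N →L[ℝ] E N, (∀ v, T' (T v) = v) ∧ (∀ v, T (T' v) = v) ∧
      ∀ p ∈ V, ∀ 𝔞, ∀ x ∈ cube N, ‖T.comp ((fderiv ℝ (f p 𝔞) x).comp T')‖ ≤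
        Real.exp δ * |dentry (f p 𝔞) x ⟨0, hN⟩ ⟨0, hN⟩| := by
  have hc := H.c_pos
  obtain ⟨T, T', h1, h2, h3⟩ := exists_adapted hN L (c * δ) (by positivity)
  refine ⟨T, T', h1, h2, fun p hp 𝔞 x hx => ?_⟩
  refine (h3 _ (H.nb p hp 𝔞 x hx) (H.tri p hp 𝔞 x hx) (H.deq p hp 𝔞 x hx)).trans ?_
  have h4 := H.lb p hp 𝔞 x hx
  have h5 := Real.add_one_le_exp δ
  change |dentry (f p 𝔞) x ⟨0, hN⟩ ⟨0, hN⟩| + c * δ ≤ _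
  nlinarith

lemma norm_le_lamP (H : Good hN f V c g2 L C θ) (δ : ℝ) (hδ : 0 < δ) :
    ∃ K > 0, ∀ p ∈ V, ∀ (w : List A) (𝔞 : ℕ → A), ∀ x ∈ cube N,
      ‖fderiv ℝ (psi f p w 𝔞) x‖ ≤ K * Real.exp (δ * w.length) * lamP hN f p w 𝔞 x := by
  obtain ⟨T, T', h1, h2, h3⟩ := H.adapted δ hδ
  refine ⟨‖T'‖ * ‖T‖ + 1, by positivity, fun p hp w 𝔞 x hx => ?_⟩
  have key : ‖T.comp ((fderiv ℝ (psi f p w 𝔞) x).comp T')‖ ≤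
      Real.exp (δ * w.length) * lamP hN f p w 𝔞 x := by
    induction w generalizing 𝔞 with
    | nil =>
      simp only [lamP, psi, List.length_nil]
      have : T.comp ((fderiv ℝ id x).comp T') = ContinuousLinearMap.id ℝ (E N) := by
        ext1 v
        simp [h2]
      rw [this]
      simpa using ContinuousLinearMap.norm_id_le
    | cons a w ih =>
      have hm := H.psi_mem hp w (consF a 𝔞) hx
      rw [H.fderiv_cons hp a w 𝔞 hx]
      set G := fderiv ℝ (f p (consF a 𝔞)) (psi f p w (consF a 𝔞) x)
      set D := fderiv ℝ (psi f p w (consF a 𝔞)) x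
      have e : T.comp ((G.comp D).comp T') = (T.comp (G.comp T')).comp (T.comp (D.comp T')) := by
        ext1 v
        simp [h1]
      rw [e]
      refine (ContinuousLinearMap.opNorm_comp_le _ _).trans ?_
      refine (mul_le_mul (h3 p hp _ _ hm) (ih _) (norm_nonneg _) (by positivity)).trans_eq ?_
      simp only [lamP, List.length_cons]
      push_cast
      rw [mul_add, Real.exp_add, mul_one]
      ring
  have e : fderiv ℝ (psi f p w 𝔞) x =
      T'.comp ((T.comp ((fderiv ℝ (psi f p w 𝔞) x).comp T')).comp T) := by
    ext1 v; simp [h1]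
  have hl := H.lamP_pos hp w 𝔞 hx
  calc ‖fderiv ℝ (psi f p w 𝔞) x‖
      = ‖T'.comp ((T.comp ((fderiv ℝ (psi f p w 𝔞) x).comp T')).comp T)‖ := by rw [← e]
    _ ≤ ‖T'‖ * (‖T.comp ((fderiv ℝ (psi f p w 𝔞) x).comp T')‖ * ‖T‖) :=
        (ContinuousLinearMap.opNorm_comp_le _ _).trans
          (mul_le_mul_of_nonneg_left (ContinuousLinearMap.opNorm_comp_le _ _) (norm_nonneg _))
    _ ≤ ‖T'‖ * ((Real.exp (δ * w.length) * lamP hN f p w 𝔞 x) * ‖T‖) := by gcongr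
    _ = (‖T'‖ * ‖T‖) * (Real.exp (δ * w.length) * lamP hN f p w 𝔞 x) := by ring
    _ ≤ (‖T'‖ * ‖T‖ + 1) * (Real.exp (δ * w.length) * lamP hN f p w 𝔞 x) := by
        gcongr; linarith
    _ = _ := by ring

lemma contraction (H : Good hN f V c g2 L C θ) (hg : 0 < g2) :
    ∃ T T' : E N →L[ℝ] E N, (∀ v, T' (T v) = v) ∧ ∃ ρ : ℝ, 0 < ρ ∧ ρ < 1 ∧
      ∀ p ∈ V, ∀ 𝔞, ∀ x ∈ cube N, ∀ y ∈ cube N,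
        ‖T (f p 𝔞 x) - T (f p 𝔞 y)‖ ≤ ρ * ‖T x - T y‖ := by
  set δ := -Real.log g2 / 2 with hδ
  have hlog : Real.log g2 < 0 := Real.log_neg hg H.g2_lt
  have hδ0 : 0 < δ := by rw [hδ]; linarith
  obtain ⟨T, T', h1, h2, h3⟩ := H.adapted δ hδ0
  refine ⟨T, T', h1, Real.exp (-δ), Real.exp_pos _, by simpa using hδ0, ?_⟩
  intro p hp 𝔞 x hx y hy
  have hconv : Convex ℝ (T' ⁻¹' cube N) := (cube_convex N).linear_preimage T'.toLinearMap
  have hd : ∀ z ∈ T' ⁻¹' cube N, HasFDerivWithinAt (fun z => T (f p 𝔞 (T' z)))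
      (T.comp ((fderiv ℝ (f p 𝔞) (T' z)).comp T')) (T' ⁻¹' cube N) z := by
    intro z hz
    have a1 := (H.diff p hp 𝔞 (T' z) hz).hasFDerivAt
    exact (T.hasFDerivAt.comp z (a1.comp z T'.hasFDerivAt)).hasFDerivWithinAt
  have hb : ∀ z ∈ T' ⁻¹' cube N, ‖T.comp ((fderiv ℝ (f p 𝔞) (T' z)).comp T')‖ ≤ Real.exp (-δ) := by
    intro z hz
    refine (h3 p hp 𝔞 _ hz).trans ?_
    have : Real.exp (-δ) = Real.exp δ * g2 := by
      have h5 : g2 = Real.exp (-2 * δ) := by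
        rw [hδ, ← Real.exp_log hg]; simp; ring
      rw [h5, ← Real.exp_add]; congr 1; ring
    rw [this]
    gcongr
    exact H.ub p hp 𝔞 _ hz
  have := hconv.norm_image_sub_le_of_norm_hasFDerivWithin_le hd hb
    (x := T y) (y := T x) (by simpa [h1] using hy) (by simpa [h1] using hx)
  simpa [h1] using this

lemma orbit {T : E N →L[ℝ] E N} {ρ : ℝ} (h0 : 0 < ρ) (h1 : ρ < 1)
    (H : Good hN f V c g2 L C θ)
    (hT : ∀ p ∈ V, ∀ 𝔞, ∀ x ∈ cube N, ∀ y ∈ cube N,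
        ‖T (f p 𝔞 x) - T (f p 𝔞 y)‖ ≤ ρ * ‖T x - T y‖)
    {D : ℝ} (hD : ∀ x ∈ cube N, ∀ y ∈ cube N, ‖T x - T y‖ ≤ D)
    {ε : ℝ} {p q : E d} (hp : p ∈ V) (hq : q ∈ V)
    (hpq : ∀ 𝔞, ∀ x ∈ cube N, ‖f p 𝔞 x - f q 𝔞 x‖ ≤ ε)
    (w : List A) (j : ℕ) (𝔞 𝔟 : ℕ → A) (hab : ∀ i < j, 𝔞 i = 𝔟 i) {x y : E N}
    (hx : x ∈ cube N) (hy : y ∈ cube N) :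
    ‖T (psi f p w 𝔞 x) - T (psi f q w 𝔟 y)‖ ≤
      ρ ^ w.length * D + ‖T‖ * (ε + C * θ ^ j) / (1 - ρ) := by
  have hε : 0 ≤ ε := (norm_nonneg _).trans (hpq 𝔞 x hx)
  have hC := H.C_pos
  have hθ := H.θ_pos
  have h1' : 0 < 1 - ρ := by linarith
  induction w generalizing 𝔞 𝔟 j with
  | nil =>
    simp only [psi, List.length_nil, pow_zero, one_mul, id]
    have := hD x hx y hy
    have : 0 ≤ ‖T‖ * (ε + C * θ ^ j) / (1 - ρ) := by positivity
    linarith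
  | cons a w ih =>
    have hab' : ∀ i < j + 1, consF a 𝔞 i = consF a 𝔟 i := by
      intro i hi
      cases i with
      | zero => rfl
      | succ k => exact hab k (by omega)
    have i1 := ih (j+1) (consF a 𝔞) (consF a 𝔟) hab'
    set X := psi f p w (consF a 𝔞) x
    set Y := psi f q w (consF a 𝔟) y
    have hX : X ∈ cube N := H.psi_mem hp _ _ hx
    have hY : Y ∈ cube N := H.psi_mem hq _ _ hy
    have e1 := hT p hp (consF a 𝔞) X hX Y hY
    have e2 := hpq (consF a 𝔞) Y hY
    have e3 := H.hol q hq _ _ _ hab' Y hY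
    have e4 : ‖T (f p (consF a 𝔞) Y) - T (f q (consF a 𝔟) Y)‖ ≤ ‖T‖ * (ε + C * θ ^ j) := by
      rw [← map_sub]
      refine (T.le_opNorm _).trans ?_
      gcongr
      calc _ = ‖(f p (consF a 𝔞) Y - f q (consF a 𝔞) Y) + (f q (consF a 𝔞) Y - f q (consF a 𝔟) Y)‖ := by
            congr 1; abel
        _ ≤ ε + C * θ ^ (j+1) := (norm_add_le _ _).trans (add_le_add e2 e3)
        _ ≤ _ := by
            gcongr ε + C * ?_
            exact pow_le_pow_of_le_one hθ.le H.θ_lt.le (Nat.le_succ j)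
    have i2 : ‖T X - T Y‖ ≤ ρ ^ w.length * D + ‖T‖ * (ε + C * θ ^ j) / (1 - ρ) := by
      refine i1.trans ?_
      have : θ ^ (j+1) ≤ θ ^ j := pow_le_pow_of_le_one hθ.le H.θ_lt.le (Nat.le_succ j)
      gcongr
    change ‖T (f p (consF a 𝔞) X) - T (f q (consF a 𝔟) Y)‖ ≤ _
    calc _ = ‖(T (f p (consF a 𝔞) X) - T (f p (consF a 𝔞) Y)) +
          (T (f p (consF a 𝔞) Y) - T (f q (consF a 𝔟) Y))‖ := by congr 1; abel
      _ ≤ ρ * (ρ ^ w.length * D + ‖T‖ * (ε + C * θ ^ j) / (1 - ρ)) + ‖T‖ * (ε + C * θ ^ j) :=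
          (norm_add_le _ _).trans (add_le_add (e1.trans (by gcongr)) e4)
      _ = _ := by
          rw [List.length_cons]
          field_simp
          ring

end Good

namespace Good

lemma lamP_dist (H : Good hN f V c g2 L C θ) (hg : 0 < g2) (δ : ℝ) (hδ : 0 < δ) :
    ∃ η > 0, ∃ K > 0, ∀ p ∈ V, ∀ q ∈ V, dist p q < η → ∀ (w : List A) (𝔞 𝔟 : ℕ → A),
      ∀ x ∈ cube N, ∀ y ∈ cube N,
        lamP hN f p w 𝔞 x ≤ K * Real.exp (δ * w.length) * lamP hN f q w 𝔟 y := by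
  have hc := H.c_pos
  obtain ⟨η1, hη1, Q, hQ⟩ := H.ucg (c * δ) (by positivity)
  obtain ⟨T, T', hTT, ρ, h0, h1, hT⟩ := H.contraction hg
  have h1' : 0 < 1 - ρ := by linarith
  obtain ⟨R, hR⟩ := (cube_compact N).isBounded.exists_norm_le
  set D := ‖T‖ * (R + R) with hDdef
  have hD : ∀ x ∈ cube N, ∀ y ∈ cube N, ‖T x - T y‖ ≤ D := by
    intro x hx y hy
    rw [← map_sub]
    refine (T.le_opNorm _).trans ?_
    rw [hDdef]; gcongr
    exact (norm_sub_le _ _).trans (add_le_add (hR x hx) (hR y hy))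
  obtain ⟨m0, hm0⟩ : ∃ m0 : ℕ, ∀ m ≥ m0, ‖T'‖ * (ρ ^ m * D) < η1 / 3 := by
    have h2 : Tendsto (fun m : ℕ => ‖T'‖ * (ρ ^ m * D)) atTop (𝓝 (‖T'‖ * (0 * D))) :=
      ((tendsto_pow_atTop_nhds_zero_of_lt_one h0.le h1).mul_const D).const_mul _
    exact eventually_atTop.1 (h2.eventually (gt_mem_nhds (by simp; positivity)))
  obtain ⟨j1, hj1⟩ : ∃ j1 : ℕ, ∀ j ≥ j1, ‖T'‖ * (‖T‖ * (C * θ ^ j) / (1 - ρ)) < η1 / 3 := by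
    have h2 : Tendsto (fun j : ℕ => ‖T'‖ * (‖T‖ * (C * θ ^ j) / (1 - ρ))) atTop
        (𝓝 (‖T'‖ * (‖T‖ * (C * 0) / (1 - ρ)))) :=
      ((((tendsto_pow_atTop_nhds_zero_of_lt_one H.θ_pos.le H.θ_lt).const_mul C).const_mul
        ‖T‖).div_const _).const_mul _
    exact eventually_atTop.1 (h2.eventually (gt_mem_nhds (by simp; positivity)))
  obtain ⟨ε, hε, hε'⟩ : ∃ ε > 0, ‖T'‖ * (‖T‖ * ε / (1 - ρ)) < η1 / 3 := by
    have h2 : Tendsto (fun ε : ℝ => ‖T'‖ * (‖T‖ * ε / (1 - ρ))) (𝓝[>] 0)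
        (𝓝 (‖T'‖ * (‖T‖ * 0 / (1 - ρ)))) := by
      apply Tendsto.mono_left _ nhdsWithin_le_nhds
      apply Continuous.tendsto (f := fun ε : ℝ => ‖T'‖ * (‖T‖ * ε / (1 - ρ)))
      fun_prop
    have h3 := h2.eventually (gt_mem_nhds
      (show ‖T'‖ * (‖T‖ * 0 / (1 - ρ)) < η1 / 3 by simp; positivity))
    obtain ⟨ε, h4, h5⟩ := (h3.and self_mem_nhdsWithin).exists
    exact ⟨ε, h5, h4⟩
  obtain ⟨η2, hη2, hf⟩ := H.ucf ε hε
  set B := max 0 (Real.log (g2 / c)) with hB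
  have hB0 : 0 ≤ B := le_max_left _ _
  have hB1 : g2 ≤ Real.exp B * c := by
    have : g2 / c ≤ Real.exp B := by
      rw [← Real.exp_log (show 0 < g2 / c by positivity)]
      exact Real.exp_le_exp.2 (le_max_right _ _)
    rwa [div_le_iff₀ hc] at this
  set j0 := max j1 Q
  refine ⟨min η1 η2, lt_min hη1 hη2, Real.exp (B * m0 + B * j0), Real.exp_pos _, ?_⟩
  intro p hp q hq hpq w 𝔞 𝔟 x hx y hy
  have hpq1 : dist p q < η1 := hpq.trans_le (min_le_left _ _)
  have hpq2 := hf p hp q hq (hpq.trans_le (min_le_right _ _))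
  have key : ∀ (w : List A) (j : ℕ) (𝔞 𝔟 : ℕ → A), (∀ i < j, 𝔞 i = 𝔟 i) →
      lamP hN f p w 𝔞 x ≤ Real.exp (δ * w.length + B * ((min w.length m0 : ℕ) : ℝ)
        + B * ((j0 - j : ℕ) : ℝ)) * lamP hN f q w 𝔟 y := by
    intro w
    induction w with
    | nil =>
      intro j 𝔞 𝔟 _
      simp only [lamP, List.length_nil, mul_one]
      apply Real.one_le_exp
      positivity
    | cons a w ih =>
      intro j 𝔞 𝔟 hab
      have hab' : ∀ i < j + 1, consF a 𝔞 i = consF a 𝔟 i := by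
        intro i hi
        cases i with
        | zero => rfl
        | succ k => exact hab k (by omega)
      have i1 := ih (j+1) _ _ hab'
      have i2 := H.orbit h0 h1 hT hD hp hq hpq2 w (j+1) _ _ hab' hx hy
      simp only [lamP]
      set X := psi f p w (consF a 𝔞) x
      set Y := psi f q w (consF a 𝔟) y
      have hX : X ∈ cube N := H.psi_mem hp _ _ hx
      have hY : Y ∈ cube N := H.psi_mem hq _ _ hy
      set gp := |dentry (f p (consF a 𝔞)) X ⟨0, hN⟩ ⟨0, hN⟩|
      set gq := |dentry (f q (consF a 𝔟)) Y ⟨0, hN⟩ ⟨0, hN⟩|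
      have b1 : gp ≤ g2 := H.ub p hp _ _ hX
      have b2 : c ≤ gq := H.lb q hq _ _ hY
      have hgp : 0 ≤ gp := abs_nonneg _
      have lq := H.lamP_pos hq w (consF a 𝔟) hy
      have lp := H.lamP_pos hp w (consF a 𝔞) hx
      have crude : gp ≤ Real.exp B * gq := b1.trans (hB1.trans (by gcongr))
      have fin : ∀ s : ℝ, gp ≤ Real.exp s * gq →
          s + (δ * w.length + B * ((min w.length m0 : ℕ) : ℝ) + B * ((j0 - (j+1) : ℕ) : ℝ)) ≤
          δ * (a :: w).length + B * ((min (a :: w).length m0 : ℕ) : ℝ) + B * ((j0 - j : ℕ) : ℝ) →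
          gp * lamP hN f p w (consF a 𝔞) x ≤
            Real.exp (δ * (a :: w).length + B * ((min (a :: w).length m0 : ℕ) : ℝ)
              + B * ((j0 - j : ℕ) : ℝ)) * (gq * lamP hN f q w (consF a 𝔟) y) := by
        intro s hs hle
        have hgq : 0 < gq := hc.trans_le b2
        refine (mul_le_mul hs i1 lp.le (by positivity)).trans ?_
        calc _ = Real.exp (s + (δ * w.length + B * ((min w.length m0 : ℕ) : ℝ) + B * ((j0 - (j+1) : ℕ) : ℝ))) * (gq * lamP hN f q w (consF a 𝔟) y) := by
              rw [Real.exp_add s]; ring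
          _ ≤ _ := by gcongr
      have mono1 : (((min w.length m0 : ℕ)) : ℝ) ≤ ((min (a :: w).length m0 : ℕ) : ℝ) := by
        norm_cast; simp only [List.length_cons]; omega
      have mono2 : ((j0 - (j+1) : ℕ) : ℝ) ≤ ((j0 - j : ℕ) : ℝ) := by
        norm_cast; omega
      have hlen : ((a :: w).length : ℝ) = w.length + 1 := by simp
      by_cases hm : w.length < m0
      · apply fin B crude
        have : ((min (a :: w).length m0 : ℕ) : ℝ) = ((min w.length m0 : ℕ) : ℝ) + 1 := by
          norm_cast; simp only [List.length_cons]; omega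
        rw [this, hlen]
        nlinarith
      by_cases hj : j < j0
      · apply fin B crude
        have : ((j0 - j : ℕ) : ℝ) = ((j0 - (j+1) : ℕ) : ℝ) + 1 := by
          norm_cast; omega
        rw [this, hlen]
        nlinarith
      push Not at hm hj
      have hXY : dist X Y < η1 := by
        have a1 := hm0 _ hm
        have a2 := hj1 (j+1) (by have := le_max_left j1 Q; omega)
        have a3 : ‖X - Y‖ ≤ ‖T'‖ * ‖T X - T Y‖ := by
          have := T'.le_opNorm (T X - T Y)
          simpa [hTT] using this
        have a4 : ‖T'‖ * ‖T X - T Y‖ ≤ ‖T'‖ * (ρ ^ w.length * D) + ‖T'‖ * (‖T‖ * ε / (1 - ρ))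
            + ‖T'‖ * (‖T‖ * (C * θ ^ (j+1)) / (1 - ρ)) := by
          calc _ ≤ ‖T'‖ * (ρ ^ w.length * D + ‖T‖ * (ε + C * θ ^ (j+1)) / (1 - ρ)) := by gcongr
            _ = _ := by ring
        rw [dist_eq_norm]
        linarith
      have hclose := hQ p hp q hq hpq1 (consF a 𝔞) (consF a 𝔟)
        (fun i hi => hab' i (by have := le_max_right j1 Q; omega)) X hX Y hY hXY
      apply fin δ
      · have := (abs_le.1 hclose).2
        change gp - gq ≤ c * δ at this
        have := Real.add_one_le_exp δ
        nlinarith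
      · rw [hlen]
        nlinarith
  refine (key w 0 𝔞 𝔟 (by simp)).trans ?_
  have := H.lamP_pos hq w 𝔟 hy
  rw [← Real.exp_add]
  have h3 : ((min w.length m0 : ℕ) : ℝ) ≤ m0 := by norm_cast; omega
  refine mul_le_mul_of_nonneg_right (Real.exp_le_exp.2 ?_) this.le
  have : B * ((min w.length m0 : ℕ) : ℝ) ≤ B * m0 := by gcongr
  rw [Nat.sub_zero]
  linarith

lemma bdd (H : Good hN f V c g2 L C θ) {p : E d} (hp : p ∈ V) (w : List A) (𝔞 : ℕ → A) :
    BddAbove ((fun x => ‖fderiv ℝ (psi f p w 𝔞) x‖) '' cube N) := by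
  obtain ⟨K, hK, h⟩ := H.norm_le_lamP 1 one_pos
  refine ⟨K * Real.exp (1 * w.length) * g2 ^ w.length, ?_⟩
  rintro _ ⟨x, hx, rfl⟩
  refine (h p hp w 𝔞 x hx).trans ?_
  gcongr
  exact (H.lamP_bounds hp w 𝔞 hx).2

lemma le_Mop (H : Good hN f V c g2 L C θ) {p : E d} (hp : p ∈ V) (w : List A) (𝔞 : ℕ → A)
    {x : E N} (hx : x ∈ cube N) : ‖fderiv ℝ (psi f p w 𝔞) x‖ ≤ Mop (psi f p w 𝔞) :=
  le_csSup (H.bdd hp w 𝔞) ⟨x, hx, rfl⟩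

lemma Mop_le {g : E N → E N} {b : ℝ} (h : ∀ x ∈ cube N, ‖fderiv ℝ g x‖ ≤ b) : Mop g ≤ b := by
  apply csSup_le (Set.Nonempty.image _ ⟨0, zero_mem_cube N⟩)
  rintro _ ⟨x, hx, rfl⟩
  exact h x hx

lemma Mop_lb (H : Good hN f V c g2 L C θ) {p : E d} (hp : p ∈ V) (w : List A) (𝔞 : ℕ → A) :
    c ^ w.length ≤ Mop (psi f p w 𝔞) :=
  ((H.lamP_bounds hp w 𝔞 (zero_mem_cube N)).1.trans
    (H.lamP_le_norm hp w 𝔞 (zero_mem_cube N))).trans (H.le_Mop hp w 𝔞 (zero_mem_cube N))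

lemma Mop_ub (H : Good hN f V c g2 L C θ) (hg : 0 < g2) :
    ∃ K > 0, ∃ ρ > 0, ρ < 1 ∧ ∀ p ∈ V, ∀ (w : List A) (𝔞 : ℕ → A),
      Mop (psi f p w 𝔞) ≤ K * ρ ^ w.length := by
  have hlog : Real.log g2 < 0 := Real.log_neg hg H.g2_lt
  set δ := -Real.log g2 / 2 with hδ
  obtain ⟨K, hK, h⟩ := H.norm_le_lamP δ (by rw [hδ]; linarith)
  refine ⟨K, hK, Real.exp δ * g2, by positivity, ?_, fun p hp w 𝔞 => Mop_le fun x hx => ?_⟩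
  · have h5 : g2 = Real.exp (-2 * δ) := by
      rw [hδ, ← Real.exp_log hg]; simp; ring
    rw [h5, ← Real.exp_add, Real.exp_lt_one_iff]
    linarith
  · refine (h p hp w 𝔞 x hx).trans ?_
    have := (H.lamP_bounds hp w 𝔞 hx).2
    rw [mul_pow, ← Real.exp_nat_mul, mul_comm (w.length : ℝ), ← mul_assoc]
    gcongr

lemma Mop_dist (H : Good hN f V c g2 L C θ) (hg : 0 < g2) (δ : ℝ) (hδ : 0 < δ) :
    ∃ η > 0, ∃ K > 0, ∀ p ∈ V, ∀ q ∈ V, dist p q < η → ∀ (w : List A) (𝔞 𝔟 : ℕ → A),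
      Mop (psi f p w 𝔞) ≤ K * Real.exp (δ * w.length) * Mop (psi f q w 𝔟) := by
  obtain ⟨η, hη, K1, hK1, h1⟩ := H.lamP_dist hg (δ/2) (by positivity)
  obtain ⟨K2, hK2, h2⟩ := H.norm_le_lamP (δ/2) (by positivity)
  refine ⟨η, hη, K2 * K1, by positivity, fun p hp q hq hpq w 𝔞 𝔟 => Mop_le fun x hx => ?_⟩
  have a1 := h2 p hp w 𝔞 x hx
  have a2 := h1 p hp q hq hpq w 𝔞 𝔟 x hx 0 (zero_mem_cube N)
  have a3 := (H.lamP_le_norm hq w 𝔟 (zero_mem_cube N)).trans (H.le_Mop hq w 𝔟 (zero_mem_cube N))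
  calc _ ≤ K2 * Real.exp (δ/2 * w.length) * (K1 * Real.exp (δ/2 * w.length) * Mop (psi f q w 𝔟)) :=
        a1.trans (by gcongr; exact a2.trans (by gcongr))
    _ = K2 * K1 * (Real.exp (δ/2 * w.length) * Real.exp (δ/2 * w.length)) * Mop (psi f q w 𝔟) := by
        ring
    _ = _ := by rw [← Real.exp_add]; congr 3; ring

lemma psi_append (p : E d) (u v : List A) (𝔞 : ℕ → A) :
    psi f p (u ++ v) 𝔞 = psi f p u 𝔞 ∘ psi f p v (app u 𝔞) := by
  induction u generalizing 𝔞 with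
  | nil => rfl
  | cons a u ih =>
    simp only [List.cons_append, psi, app, ih]
    rfl

lemma Mop_mul (H : Good hN f V c g2 L C θ) {p : E d} (hp : p ∈ V) (u v : List A) (𝔞 : ℕ → A) :
    Mop (psi f p (u ++ v) 𝔞) ≤ Mop (psi f p u 𝔞) * Mop (psi f p v (app u 𝔞)) := by
  refine Mop_le fun x hx => ?_
  rw [psi_append]
  have hm := H.psi_mem hp v (app u 𝔞) hx
  rw [fderiv_comp x (H.psi_diff hp u 𝔞 hm) (H.psi_diff hp v _ hx)]
  refine (ContinuousLinearMap.opNorm_comp_le _ _).trans ?_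
  have a1 := H.le_Mop hp u 𝔞 hm
  exact mul_le_mul a1 (H.le_Mop hp v _ hx) (norm_nonneg _) ((norm_nonneg _).trans a1)

end Good

end Dyn

section Press

variable {A : Type} [Fintype A]

structure PH (M : List A → (ℕ → A) → ℝ) : Prop where
  lb : ∃ c > 0, ∀ w 𝔞, c ^ w.length ≤ M w 𝔞
  ub : ∃ K > 0, ∃ ρ > 0, ρ < 1 ∧ ∀ w 𝔞, M w 𝔞 ≤ K * ρ ^ w.length
  mul : ∀ u v 𝔞, M (u ++ v) 𝔞 ≤ M u 𝔞 * M v (app u 𝔞)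
  dis : ∀ δ > 0, ∃ K > 0, ∀ w 𝔞 𝔟, M w 𝔞 ≤ K * Real.exp (δ * w.length) * M w 𝔟

def ZZ (M : List A → (ℕ → A) → ℝ) (n : ℕ) (s : ℝ) (𝔞 : ℕ → A) : ℝ :=
  ∑ w : Fin n → A, M (List.ofFn w) 𝔞 ^ s

lemma PH.pos {M : List A → (ℕ → A) → ℝ} (H : PH M) (w 𝔞) : 0 < M w 𝔞 := by
  obtain ⟨c, hc, h⟩ := H.lb
  exact lt_of_lt_of_le (pow_pos hc _) (h w 𝔞)

lemma PH.Zpos [Nonempty A] {M : List A → (ℕ → A) → ℝ} (H : PH M) (n s 𝔞) : 0 < ZZ M n s 𝔞 :=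
  Finset.sum_pos (fun w _ => Real.rpow_pos_of_pos (H.pos _ _) _) Finset.univ_nonempty

lemma Z_cmp [Nonempty A] {M M' : List A → (ℕ → A) → ℝ} (H : PH M) (H' : PH M') {K δ : ℝ} (hK : 0 < K)
    {𝔞 𝔟 : ℕ → A} (h : ∀ w, M w 𝔞 ≤ K * Real.exp (δ * w.length) * M' w 𝔟) (n : ℕ) {s : ℝ}
    (hs : 0 ≤ s) :
    Real.log (ZZ M n s 𝔞) ≤ s * Real.log K + s * δ * n + Real.log (ZZ M' n s 𝔟) := by
  have h1 : ZZ M n s 𝔞 ≤ (K * Real.exp (δ * n)) ^ s * ZZ M' n s 𝔟 := by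
    unfold ZZ
    rw [Finset.mul_sum]
    refine Finset.sum_le_sum fun w _ => ?_
    rw [← Real.mul_rpow (by positivity) (H'.pos _ _).le]
    apply Real.rpow_le_rpow (H.pos _ _).le _ hs
    simpa using h (List.ofFn w)
  have h2 := Real.log_le_log (H.Zpos n s 𝔞) h1
  have h3 := H'.Zpos n s 𝔟
  rw [Real.log_mul (by positivity) h3.ne', Real.log_rpow (by positivity),
    Real.log_mul hK.ne' (Real.exp_pos _).ne', Real.log_exp] at h2
  linarith

lemma Z_mul [Nonempty A] {M : List A → (ℕ → A) → ℝ} (H : PH M) (m n : ℕ) {s : ℝ} (hs : 0 ≤ s) (𝔞 : ℕ → A)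
    {b : ℝ} (hb : ∀ 𝔟, ZZ M n s 𝔟 ≤ b) : ZZ M (m + n) s 𝔞 ≤ ZZ M m s 𝔞 * b := by
  have e : ZZ M (m + n) s 𝔞 = ∑ u : Fin m → A, ∑ v : Fin n → A,
      M (List.ofFn u ++ List.ofFn v) 𝔞 ^ s := by
    unfold ZZ
    rw [← Fintype.sum_prod_type', ← (Fin.appendEquiv m n).sum_comp]
    refine Finset.sum_congr rfl fun w _ => ?_
    simp [Fin.appendEquiv, List.ofFn_fin_append]
  rw [e, ZZ, Finset.sum_mul]
  refine Finset.sum_le_sum fun u _ => ?_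
  have hu := H.pos (List.ofFn u) 𝔞
  calc _ ≤ ∑ v : Fin n → A, M (List.ofFn u) 𝔞 ^ s * M (List.ofFn v) (app (List.ofFn u) 𝔞) ^ s := by
        refine Finset.sum_le_sum fun v _ => ?_
        rw [← Real.mul_rpow hu.le (H.pos _ _).le]
        exact Real.rpow_le_rpow (H.pos _ _).le (H.mul _ _ _) hs
    _ = M (List.ofFn u) 𝔞 ^ s * ZZ M n s (app (List.ofFn u) 𝔞) := by
        rw [ZZ, Finset.mul_sum]
    _ ≤ _ := by gcongr; exact hb _

lemma exists_limit [Nonempty A] {M : List A → (ℕ → A) → ℝ} (H : PH M) {s : ℝ} (hs : 0 ≤ s) :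
    ∃ l : ℝ, ∀ 𝔞, Tendsto (fun n : ℕ => (1 / n : ℝ) * Real.log (ZZ M n s 𝔞)) atTop (𝓝 l) := by
  have bdd : ∀ n, BddAbove (range fun 𝔞 => ZZ M n s 𝔞) := by
    intro n
    obtain ⟨K, hK, ρ, hρ, _, h⟩ := H.ub
    refine ⟨∑ w : Fin n → A, (K * ρ ^ n) ^ s, ?_⟩
    rintro _ ⟨𝔞, rfl⟩
    refine Finset.sum_le_sum fun w _ => Real.rpow_le_rpow (H.pos _ _).le ?_ hs
    simpa using h (List.ofFn w) 𝔞
  set W : ℕ → ℝ := fun n => ⨆ 𝔞, ZZ M n s 𝔞 with hW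
  have le_W : ∀ n 𝔞, ZZ M n s 𝔞 ≤ W n := fun n 𝔞 => le_ciSup (bdd n) 𝔞
  have 𝔞₀ : ℕ → A := fun _ => Classical.arbitrary A
  have Wpos : ∀ n, 0 < W n := fun n => (H.Zpos n s 𝔞₀).trans_le (le_W n 𝔞₀)
  have sub : Subadditive fun n => Real.log (W n) := by
    intro m n
    rw [← Real.log_mul (Wpos m).ne' (Wpos n).ne']
    apply Real.log_le_log (Wpos _)
    refine ciSup_le fun 𝔞 => (Z_mul H m n hs 𝔞 (le_W n)).trans ?_
    exact mul_le_mul_of_nonneg_right (le_W m 𝔞) (Wpos n).le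
  obtain ⟨c, hc, hlb⟩ := H.lb
  have hbelow : BddBelow (range fun n : ℕ => Real.log (W n) / n) := by
    refine ⟨min 0 (s * Real.log c), ?_⟩
    rintro _ ⟨n, rfl⟩
    rcases Nat.eq_zero_or_pos n with h0 | h0
    · subst h0; simp
    refine (min_le_right _ _).trans ?_
    have hn : (0:ℝ) < n := by exact_mod_cast h0
    rw [le_div_iff₀ hn]
    have h1 : (c ^ n) ^ s ≤ W n := by
      refine le_trans ?_ (le_W n 𝔞₀)
      have w0 : Fin n → A := fun _ => Classical.arbitrary A
      refine le_trans ?_ (Finset.single_le_sum (f := fun w : Fin n → A => M (List.ofFn w) 𝔞₀ ^ s)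
        (fun w _ => (Real.rpow_pos_of_pos (H.pos _ _) _).le) (Finset.mem_univ w0))
      apply Real.rpow_le_rpow (by positivity) _ hs
      simpa using hlb (List.ofFn w0) 𝔞₀
    have h2 := Real.log_le_log (by positivity) h1
    rw [Real.log_rpow (by positivity), Real.log_pow] at h2
    linarith
  refine ⟨sub.lim, fun 𝔞 => ?_⟩
  have t1 := sub.tendsto_lim hbelow
  have t2 : Tendsto (fun n : ℕ => Real.log (W n) / n - (1 / n : ℝ) * Real.log (ZZ M n s 𝔞)) atTop (𝓝 0) := by
    rw [Metric.tendsto_atTop]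
    intro ε hε
    set δ := ε / (2 * (s + 1)) with hδ
    have hδ0 : 0 < δ := by positivity
    have hsδ : s * δ < ε / 2 + 0 := by
      rw [hδ]
      have : s * (ε / (2 * (s + 1))) = ε / 2 * (s / (s + 1)) := by field_simp
      rw [this, add_zero]
      have h5 : s / (s + 1) < 1 := by rw [div_lt_one (by positivity)]; linarith
      nlinarith
    obtain ⟨K, hK, hdis⟩ := H.dis δ hδ0
    have hle : ∀ n, Real.log (W n) ≤ s * Real.log K + s * δ * n + Real.log (ZZ M n s 𝔞) := by
      intro n
      have h3 := H.Zpos n s 𝔞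
      have : W n ≤ Real.exp (s * Real.log K + s * δ * n + Real.log (ZZ M n s 𝔞)) := by
        refine ciSup_le fun 𝔟 => ?_
        have := Z_cmp H H hK (fun w => hdis w 𝔟 𝔞) n hs
        rwa [Real.log_le_iff_le_exp (H.Zpos n s 𝔟)] at this
      rwa [Real.log_le_iff_le_exp (Wpos n)]
    have t3 : Tendsto (fun n : ℕ => s * Real.log K / (n:ℝ)) atTop (𝓝 0) :=
      tendsto_const_div_atTop_nhds_zero_nat _
    have ev := t3.eventually (gt_mem_nhds (show (0:ℝ) < ε / 2 by positivity))
    obtain ⟨n0, hn0⟩ := eventually_atTop.1 ev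
    refine ⟨max n0 1, fun n hn => ?_⟩
    have h1 := hn0 n (le_trans (le_max_left _ _) hn)
    have hn1 : (0:ℝ) < n := by
      have : 1 ≤ n := le_trans (le_max_right _ _) hn
      exact_mod_cast this
    have e : Real.log (W n) / n - (1 / n : ℝ) * Real.log (ZZ M n s 𝔞)
      = (Real.log (W n) - Real.log (ZZ M n s 𝔞)) / n := by ring
    have low : Real.log (ZZ M n s 𝔞) ≤ Real.log (W n) := Real.log_le_log (H.Zpos n s 𝔞) (le_W n 𝔞)
    rw [Real.dist_eq, sub_zero, e, abs_of_nonneg (div_nonneg (by linarith) hn1.le)]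
    have : (Real.log (W n) - Real.log (ZZ M n s 𝔞)) / n ≤ s * Real.log K / n + s * δ := by
      rw [div_le_iff₀ hn1, add_mul, div_mul_cancel₀ _ hn1.ne']
      linarith [hle n]
    linarith
  have := t1.sub t2
  simpa using this

lemma lim_cmp {x y : ℕ → ℝ} {l l' κ β : ℝ}
    (hx : Tendsto (fun n : ℕ => (1 / n : ℝ) * x n) atTop (𝓝 l))
    (hy : Tendsto (fun n : ℕ => (1 / n : ℝ) * y n) atTop (𝓝 l'))
    (h : ∀ n : ℕ, x n ≤ κ + β * n + y n) : l ≤ l' + β := by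
  have t3 : Tendsto (fun n : ℕ => κ / (n:ℝ)) atTop (𝓝 0) :=
    tendsto_const_div_atTop_nhds_zero_nat _
  have t4 := (hy.add_const β).add t3
  rw [add_zero] at t4
  refine le_of_tendsto_of_tendsto hx t4 ?_
  filter_upwards [eventually_ge_atTop 1] with n hn
  have hn1 : (0:ℝ) < n := by exact_mod_cast hn
  have := h n
  calc (1 / n : ℝ) * x n ≤ (1 / n : ℝ) * (κ + β * n + y n) := by gcongr
    _ = _ := by field_simp; ring

lemma pressure_props (hA : 2 ≤ Fintype.card A) {M : List A → (ℕ → A) → ℝ} (H : PH M)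
    {P : ℝ → ℝ} (𝔞 : ℕ → A)
    (hP : ∀ s, 0 ≤ s → Tendsto (fun n : ℕ => (1 / n : ℝ) * Real.log (ZZ M n s 𝔞)) atTop (𝓝 (P s))) :
    StrictAntiOn P (Ici 0) ∧ ContinuousOn P (Ici 0) ∧ 0 < P 0 ∧ Tendsto P atTop atBot ∧
      ∃! s : ℝ, 0 ≤ s ∧ P s = 0 := by
  have : Nonempty A := Fintype.card_pos_iff.1 (by omega)
  obtain ⟨K, hK, ρ, hρ, hρ1, hub⟩ := H.ub
  obtain ⟨c, hc, hlb⟩ := H.lb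
  have lρ : Real.log ρ < 0 := Real.log_neg hρ hρ1
  have up : ∀ s t, 0 ≤ s → s ≤ t → P t ≤ P s + (t - s) * Real.log ρ := by
    intro s t hs hst
    refine lim_cmp (κ := (t - s) * Real.log K) (hP t (hs.trans hst)) (hP s hs) fun n => ?_
    have h1 : ZZ M n t 𝔞 ≤ (K * ρ ^ n) ^ (t - s) * ZZ M n s 𝔞 := by
      unfold ZZ
      rw [Finset.mul_sum]
      refine Finset.sum_le_sum fun w _ => ?_
      have hm := H.pos (List.ofFn w) 𝔞
      have : M (List.ofFn w) 𝔞 ^ t = M (List.ofFn w) 𝔞 ^ (t - s) * M (List.ofFn w) 𝔞 ^ s := by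
        rw [← Real.rpow_add hm]; congr 1; ring
      rw [this]
      have h2 := hub (List.ofFn w) 𝔞
      rw [List.length_ofFn] at h2
      exact mul_le_mul_of_nonneg_right (Real.rpow_le_rpow hm.le h2 (by linarith)) (by positivity)
    have h2 := Real.log_le_log (H.Zpos n t 𝔞) h1
    rw [Real.log_mul (by positivity) (H.Zpos n s 𝔞).ne', Real.log_rpow (by positivity),
      Real.log_mul hK.ne' (by positivity), Real.log_pow] at h2
    linarith
  have low : ∀ s t, 0 ≤ s → s ≤ t → P s ≤ P t + (-((t - s) * Real.log c)) := by
    intro s t hs hst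
    refine lim_cmp (κ := 0) (hP s hs) (hP t (hs.trans hst)) fun n => ?_
    have h1 : (c ^ n) ^ (t - s) * ZZ M n s 𝔞 ≤ ZZ M n t 𝔞 := by
      unfold ZZ
      rw [Finset.mul_sum]
      refine Finset.sum_le_sum fun w _ => ?_
      have hm := H.pos (List.ofFn w) 𝔞
      have : M (List.ofFn w) 𝔞 ^ t = M (List.ofFn w) 𝔞 ^ (t - s) * M (List.ofFn w) 𝔞 ^ s := by
        rw [← Real.rpow_add hm]; congr 1; ring
      rw [this]
      have h2 := hlb (List.ofFn w) 𝔞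
      rw [List.length_ofFn] at h2
      exact mul_le_mul_of_nonneg_right (Real.rpow_le_rpow (by positivity) h2 (by linarith))
        (by positivity)
    have hz := H.Zpos n s 𝔞
    have h2 := Real.log_le_log (by positivity) h1
    rw [Real.log_mul (by positivity) (H.Zpos n s 𝔞).ne', Real.log_rpow (by positivity),
      Real.log_pow] at h2
    linarith
  have anti : StrictAntiOn P (Ici 0) := by
    intro s hs t ht hst
    have := up s t hs hst.le
    nlinarith
  have cont : ContinuousOn P (Ici 0) := by
    have key : ∀ s t, 0 ≤ s → s ≤ t → |P s - P t| ≤ |Real.log c| * |s - t| := by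
      intro s t hs hst
      have h1 := up s t hs hst
      have h2 := low s t hs hst
      have h3 : (t - s) * Real.log ρ ≤ 0 := mul_nonpos_of_nonneg_of_nonpos (by linarith) lρ.le
      have h4 : (t - s) * (-Real.log c) ≤ (t - s) * |Real.log c| :=
        mul_le_mul_of_nonneg_left (neg_le_abs _) (by linarith)
      rw [abs_of_nonneg (by linarith), abs_sub_comm s t, abs_of_nonneg (by linarith : 0 ≤ t - s)]
      linarith
    have hl : LipschitzOnWith (Real.nnabs (Real.log c)) P (Ici 0) := by
      apply LipschitzOnWith.of_dist_le_mul
      intro s hs t ht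
      rw [Real.dist_eq, Real.dist_eq]
      rcases le_total s t with h | h
      · simpa using key s t hs h
      · rw [abs_sub_comm, abs_sub_comm s t]
        simpa using key t s ht h
    exact hl.continuousOn
  have P0 : 0 < P 0 := by
    have e : P 0 = Real.log (Fintype.card A) := by
      refine tendsto_nhds_unique (hP 0 le_rfl) ?_
      refine tendsto_const_nhds.congr' ?_
      filter_upwards [eventually_ge_atTop 1] with n hn
      have hn1 : (0:ℝ) < n := by exact_mod_cast hn
      simp [ZZ]
      field_simp
    rw [e]
    apply Real.log_pos
    exact_mod_cast hA
  have bot : Tendsto P atTop atBot := by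
    have h1 : Tendsto (fun t : ℝ => P 0 + (t - 0) * Real.log ρ) atTop atBot := by
      apply tendsto_atBot_add_const_left
      simp only [sub_zero]
      exact tendsto_id.atTop_mul_const_of_neg lρ
    refine tendsto_atBot_mono' _ ?_ h1
    filter_upwards [eventually_ge_atTop 0] with t ht
    exact up 0 t le_rfl ht
  refine ⟨anti, cont, P0, bot, ?_⟩
  obtain ⟨b, hb1, hb2⟩ := ((bot.eventually (eventually_lt_atBot 0)).and (eventually_ge_atTop 0)).exists
  obtain ⟨s, hs, hs0⟩ := intermediate_value_Icc' hb2 (cont.mono Icc_subset_Ici_self)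
    ⟨hb1.le, P0.le⟩
  refine ⟨s, ⟨hs.1, hs0⟩, fun t ht => ?_⟩
  exact anti.injOn ht.1 hs.1 (ht.2.trans hs0.symm)

end Press

section Final

lemma SkewFamily.diffAt {A : Type} {N d : ℕ} {r : ℕ∞} (hr : 2 ≤ r) (S : SkewFamily A N d r)
    (𝔞 : ℕ → A) {p : E d} (hp : p ∈ S.P') {x : E N} (hx : x ∈ S.X') :
    HasFDerivAt (S.f p 𝔞) ((fderiv ℝ (fun q : E d × E N => S.f q.1 𝔞 q.2) (p, x)).comp
      (ContinuousLinearMap.inr ℝ (E d) (E N))) x := by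
  have ho : IsOpen (S.P' ×ˢ S.X') := S.P'_open.prod S.X'_open
  have hr1 : (1 : WithTop ℕ∞) ≤ r := by
    have : (1 : ℕ∞) ≤ r := le_trans (by norm_num) hr
    exact_mod_cast this
  have h1 : DifferentiableAt ℝ (fun q : E d × E N => S.f q.1 𝔞 q.2) (p, x) :=
    ((S.smooth 𝔞).differentiableOn (by positivity)).differentiableAt (ho.mem_nhds ⟨hp, hx⟩)
  have h2 : HasFDerivAt (fun y : E N => (p, y)) (ContinuousLinearMap.inr ℝ (E d) (E N)) x :=
    hasFDerivAt_prodMk_right p x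
  exact HasFDerivAt.comp (f := fun y : E N => (p, y)) x h1.hasFDerivAt h2

lemma SkewFamily.contG {A : Type} {N d : ℕ} {r : ℕ∞} (hr : 2 ≤ r) (S : SkewFamily A N d r)
    (𝔞 : ℕ → A) :
    ContinuousOn (fun q : E d × E N => fderiv ℝ (S.f q.1 𝔞) q.2) (S.P' ×ˢ S.X') := by
  have ho : IsOpen (S.P' ×ˢ S.X') := S.P'_open.prod S.X'_open
  have hr1 : (1 : WithTop ℕ∞) ≤ r := by
    have : (1 : ℕ∞) ≤ r := le_trans (by norm_num) hr
    exact_mod_cast this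
  have h1 := (S.smooth 𝔞).continuousOn_fderiv_of_isOpen ho hr1
  have h2 : ContinuousOn (fun q : E d × E N =>
      (fderiv ℝ (fun q : E d × E N => S.f q.1 𝔞 q.2) q).comp
      (ContinuousLinearMap.inr ℝ (E d) (E N))) (S.P' ×ˢ S.X') :=
    h1.clm_comp continuousOn_const
  refine h2.congr fun q hq => ?_
  exact (S.diffAt hr 𝔞 hq.1 hq.2).fderiv

lemma pow_small {C θ : ℝ} (h0 : 0 < θ) (h1 : θ < 1) {ε : ℝ} (hε : 0 < ε) : ∃ q : ℕ, C * θ ^ q ≤ ε := by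
  have h2 := (tendsto_pow_atTop_nhds_zero_of_lt_one h0.le h1).const_mul C
  rw [mul_zero] at h2
  obtain ⟨q, hq⟩ := (h2.eventually (gt_mem_nhds hε)).exists
  exact ⟨q, hq.le⟩

lemma exists_good {A : Type} [Fintype A] [Nonempty A] {N d : ℕ} {r : ℕ∞} (hN : 0 < N)
    (hr : 2 ≤ r) (S : SkewFamily A N d r) (hU : UnipOn hN S.f S.P' S.X') {p₀ : E d}
    (hp₀ : p₀ ∈ S.P') :
    ∃ V ∈ 𝓝 p₀, ∃ c g2 L C θ : ℝ, Good hN S.f V c g2 L C θ := by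
  obtain ⟨R, hR, hRP⟩ := Metric.nhds_basis_closedBall.mem_iff.1 (S.P'_open.mem_nhds hp₀)
  set V := Metric.closedBall p₀ R
  have hX := S.X_subset
  set K : Set (E d × E N) := V ×ˢ cube N
  have hK : IsCompact K := (isCompact_closedBall p₀ R).prod (cube_compact N)
  have hKs : K ⊆ S.P' ×ˢ S.X' := Set.prod_mono hRP hX
  obtain ⟨C0, hC0, θ0, ⟨hθ0, hθ0'⟩, hol0⟩ := S.holder0
  obtain ⟨C1, hC1, θ1, ⟨hθ1, hθ1'⟩, hol1⟩ := S.holder1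
  let i0 : Fin N := ⟨0, hN⟩
  let g : (ℕ → A) → E d × E N → ℝ := fun 𝔞 q => |dentry (S.f q.1 𝔞) q.2 i0 i0|
  have gcont : ∀ 𝔞, ContinuousOn (g 𝔞) K := by
    intro 𝔞
    have h1 := (S.contG hr 𝔞).mono hKs
    have h2 : ContinuousOn (fun q : E d × E N =>
        fderiv ℝ (S.f q.1 𝔞) q.2 (EuclideanSpace.single i0 (1:ℝ))) K :=
      h1.clm_apply continuousOn_const
    have h3 : Continuous fun v : E N => |v i0| := by fun_prop
    exact h3.comp_continuousOn h2
  have gq : ∀ ε > (0:ℝ), ∃ q : ℕ, ∀ 𝔞 𝔟 : ℕ → A, (∀ i < q, 𝔞 i = 𝔟 i) →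
      ∀ y ∈ K, dist (g 𝔞 y) (g 𝔟 y) ≤ ε := by
    intro ε hε
    obtain ⟨q, hq⟩ := pow_small (C := C1) hθ1 hθ1' hε
    refine ⟨q, fun 𝔞 𝔟 hab y hy => ?_⟩
    have h1 := hol1 y.1 (hKs hy).1 𝔞 𝔟 q hab y.2 (hKs hy).2
    have h2 := entry_le (fderiv ℝ (S.f y.1 𝔞) y.2 - fderiv ℝ (S.f y.1 𝔟) y.2) i0 i0
    rw [Real.dist_eq]
    refine (abs_abs_sub_abs_le_abs_sub _ _).trans ?_
    refine le_trans (le_of_eq ?_) (h2.trans (h1.trans hq))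
    simp [dentry]
  obtain ⟨c, hc, hlb⟩ := exists_lb hK g gcont gq
    (fun 𝔞 y hy => (hU y.1 (hKs hy).1 𝔞 y.2 (hKs hy).2).2.2.1)
  obtain ⟨c', hc', hub⟩ := exists_lb hK (fun 𝔞 y => 1 - g 𝔞 y)
    (fun 𝔞 => continuousOn_const.sub (gcont 𝔞))
    (fun ε hε => by
      obtain ⟨q, hq⟩ := gq ε hε
      refine ⟨q, fun 𝔞 𝔟 hab y hy => ?_⟩
      have := hq 𝔞 𝔟 hab y hy
      rw [Real.dist_eq] at this ⊢
      rw [abs_sub_comm] at this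
      convert this using 2
      ring)
    (fun 𝔞 y hy => by
      have := (hU y.1 (hKs hy).1 𝔞 y.2 (hKs hy).2).2.2.2
      change |dentry (S.f y.1 𝔞) y.2 i0 i0| < 1 at this
      simp only [g]; linarith)
  let 𝔠 : ℕ → A := fun _ => Classical.arbitrary A
  obtain ⟨L, hL⟩ := hK.exists_bound_of_continuousOn ((S.contG hr 𝔠).mono hKs)
  refine ⟨V, Metric.closedBall_mem_nhds p₀ hR, c, 1 - c', L + C1, C0, θ0, ?_⟩
  refine
    { diff := fun p hp 𝔞 x hx => (S.diffAt hr 𝔞 (hRP hp) (hX hx)).differentiableAt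
      maps := fun p hp 𝔞 x hx => S.into 𝔞 p (hRP hp) ⟨x, hX hx, rfl⟩
      tri := fun p hp 𝔞 x hx => (hU p (hRP hp) 𝔞 x (hX hx)).1
      deq := fun p hp 𝔞 x hx => (hU p (hRP hp) 𝔞 x (hX hx)).2.1
      c_pos := hc
      g2_lt := by linarith
      lb := fun p hp 𝔞 x hx => hlb 𝔞 (p, x) ⟨hp, hx⟩
      ub := fun p hp 𝔞 x hx => by
        have := hub 𝔞 (p, x) ⟨hp, hx⟩
        change c' ≤ 1 - |dentry (S.f p 𝔞) x ⟨0, hN⟩ ⟨0, hN⟩| at this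
        linarith
      nb := fun p hp 𝔞 x hx => by
        have h1 := hL (p, x) ⟨hp, hx⟩
        have h2 := hol1 p (hRP hp) 𝔞 𝔠 0 (by simp) x (hX hx)
        have h3 := norm_add_le (fderiv ℝ (S.f p 𝔠) x) (fderiv ℝ (S.f p 𝔞) x - fderiv ℝ (S.f p 𝔠) x)
        rw [add_sub_cancel] at h3
        simp only [pow_zero, mul_one] at h2
        simp only at h1
        linarith
      C_pos := hC0
      θ_pos := hθ0
      θ_lt := hθ0'
      hol := fun p hp 𝔞 𝔟 q hab x hx => hol0 p (hRP hp) 𝔞 𝔟 q hab x (hX hx)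
      ucf := fun ε hε => by
        obtain ⟨η, hη, Q, h⟩ := exists_uc hK (fun 𝔞 (q : E d × E N) => S.f q.1 𝔞 q.2)
          (fun 𝔞 => ((S.smooth 𝔞).continuousOn).mono hKs)
          (fun ε hε => by
            obtain ⟨q, hq⟩ := pow_small (C := C0) hθ0 hθ0' hε
            refine ⟨q, fun 𝔞 𝔟 hab y hy => ?_⟩
            rw [dist_eq_norm]
            exact (hol0 y.1 (hKs hy).1 𝔞 𝔟 q hab y.2 (hKs hy).2).trans hq) ε hε
        refine ⟨η, hη, fun p hp q hq hpq 𝔞 x hx => ?_⟩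
        have := h 𝔞 𝔞 (fun _ _ => rfl) (p, x) ⟨hp, hx⟩ (q, x) ⟨hq, hx⟩
          (by rw [Prod.dist_eq]; exact max_lt hpq (by simpa using hη))
        rwa [dist_eq_norm] at this
      ucg := fun ε hε => by
        obtain ⟨η, hη, Q, h⟩ := exists_uc hK g gcont gq ε hε
        refine ⟨η, hη, Q, fun p hp q hq hpq 𝔞 𝔟 hab x hx y hy hxy => ?_⟩
        have := h 𝔞 𝔟 hab (p, x) ⟨hp, hx⟩ (q, y) ⟨hq, hy⟩
          (by simpa [Prod.dist_eq] using ⟨hpq, hxy⟩)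
        rwa [Real.dist_eq] at this }

lemma Good.ph {A : Type} {N d : ℕ} {hN : 0 < N}
    {f : E d → (ℕ → A) → E N → E N} {V : Set (E d)} {c g2 L C θ : ℝ}
    (H : Good hN f V c g2 L C θ) (hg : 0 < g2) {p : E d} (hp : p ∈ V) :
    PH fun w 𝔞 => Mop (psi f p w 𝔞) where
  lb := ⟨c, H.c_pos, fun w 𝔞 => H.Mop_lb hp w 𝔞⟩
  ub := by
    obtain ⟨K, hK, ρ, hρ, h1, h⟩ := H.Mop_ub hg
    exact ⟨K, hK, ρ, hρ, h1, h p hp⟩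
  mul := H.Mop_mul hp
  dis := fun δ hδ => by
    obtain ⟨η, hη, K, hK, h⟩ := H.Mop_dist hg δ hδ
    exact ⟨K, hK, h p hp p hp (by simpa using hη)⟩

end Final

/-- Proposition: properties of the pressure function and of the similarity dimension. -/
theorem proposition_pression {A : Type} [Fintype A] {N d : ℕ} {r : ℕ∞}
    (hA : 2 ≤ Fintype.card A) (hN : 0 < N) (hd : 0 < d) (hr : 2 ≤ r)
    (S : SkewFamily A N d r)
    (hU : UnipOn hN S.f S.P' S.X')
    (γ' γ : ℝ) (hγ : GammaBounds hN S.f γ' γ) :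
    (∀ p ∈ S.P', ∀ 𝔞 : ℕ → A,
      (∀ s : ℝ, 0 ≤ s →
        Tendsto (fun n : ℕ => (1 / n : ℝ) *
            Real.log (∑ w : Fin n → A, Mop (psi S.f p (List.ofFn w) 𝔞) ^ s))
          atTop (𝓝 (pressure S.f p 𝔞 s))) ∧
      StrictAntiOn (pressure S.f p 𝔞) (Ici 0) ∧
      ContinuousOn (pressure S.f p 𝔞) (Ici 0) ∧
      (∀ 𝔟 : ℕ → A, ∀ s : ℝ, 0 ≤ s → pressure S.f p 𝔞 s = pressure S.f p 𝔟 s) ∧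
      0 < pressure S.f p 𝔞 0 ∧
      Tendsto (pressure S.f p 𝔞) atTop atBot ∧
      (∃! s : ℝ, 0 ≤ s ∧ pressure S.f p 𝔞 s = 0)) ∧
    (∀ (Δ : E d → ℝ) (𝔞₀ : ℕ → A),
      (∀ p ∈ S.P', 0 ≤ Δ p ∧ pressure S.f p 𝔞₀ (Δ p) = 0) → ContinuousOn Δ S.P') := by
  have hne : Nonempty A := Fintype.card_pos_iff.1 (by omega)
  have ph : ∀ p ∈ S.P', PH fun w 𝔞 => Mop (psi S.f p w 𝔞) := by
    intro p hp
    obtain ⟨V, hV, c, g2, L, C, θ, H⟩ := exists_good hN hr S hU hp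
    have hpV := mem_of_mem_nhds hV
    exact H.ph (H.g2_nonneg hpV fun _ => Classical.arbitrary A) hpV
  have lim : ∀ p ∈ S.P', ∀ s : ℝ, 0 ≤ s → ∀ 𝔞 𝔟 : ℕ → A,
      Tendsto (fun n : ℕ => (1 / n : ℝ) *
            Real.log (∑ w : Fin n → A, Mop (psi S.f p (List.ofFn w) 𝔞) ^ s))
          atTop (𝓝 (pressure S.f p 𝔟 s)) := by
    intro p hp s hs 𝔞 𝔟
    obtain ⟨l, hl⟩ := exists_limit (ph p hp) hs
    have : pressure S.f p 𝔟 s = l := (hl 𝔟).limUnder_eq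
    rw [this]
    exact hl 𝔞
  have props := fun p (hp : p ∈ S.P') (𝔞 : ℕ → A) =>
    pressure_props hA (ph p hp) 𝔞 (P := pressure S.f p 𝔞) fun s hs => lim p hp s hs 𝔞 𝔞
  refine ⟨fun p hp 𝔞 => ?_, ?_⟩
  · obtain ⟨h1, h2, h3, h4, h5⟩ := props p hp 𝔞
    exact ⟨fun s hs => lim p hp s hs 𝔞 𝔞, h1, h2, fun 𝔟 s hs =>
      tendsto_nhds_unique (lim p hp s hs 𝔞 𝔞) (lim p hp s hs 𝔞 𝔟), h3, h4, h5⟩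
  intro Δ 𝔞₀ hΔ
  have pc : ∀ s : ℝ, 0 ≤ s → ∀ p₀ ∈ S.P', ContinuousAt (fun p => pressure S.f p 𝔞₀ s) p₀ := by
    intro s hs p₀ hp₀
    obtain ⟨V, hV, c, g2, L, C, θ, H⟩ := exists_good hN hr S hU hp₀
    have hpV := mem_of_mem_nhds hV
    have hg := H.g2_nonneg hpV 𝔞₀
    rw [Metric.continuousAt_iff']
    intro ε hε
    obtain ⟨η, hη, K, hK, h⟩ := H.Mop_dist hg (ε / (s + 1)) (by positivity)
    have hsε : s * (ε / (s + 1)) < ε := by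
      have h5 : s / (s + 1) < 1 := by rw [div_lt_one (by positivity)]; linarith
      have : s * (ε / (s + 1)) = ε * (s / (s + 1)) := by ring
      rw [this]
      nlinarith
    filter_upwards [hV, S.P'_open.mem_nhds hp₀, Metric.ball_mem_nhds p₀ hη] with p h1 h2 h3
    have a1 := lim_cmp (lim p h2 s hs 𝔞₀ 𝔞₀) (lim p₀ hp₀ s hs 𝔞₀ 𝔞₀)
      (Z_cmp (ph p h2) (ph p₀ hp₀) hK (𝔞 := 𝔞₀) (𝔟 := 𝔞₀)
        (fun w => h p h1 p₀ hpV h3 w 𝔞₀ 𝔞₀) · hs)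
    have a2 := lim_cmp (lim p₀ hp₀ s hs 𝔞₀ 𝔞₀) (lim p h2 s hs 𝔞₀ 𝔞₀)
      (Z_cmp (ph p₀ hp₀) (ph p h2) hK (𝔞 := 𝔞₀) (𝔟 := 𝔞₀)
        (fun w => h p₀ hpV p h1 (by rw [dist_comm]; exact h3) w 𝔞₀ 𝔞₀) · hs)
    rw [Real.dist_eq, abs_lt]
    constructor <;> linarith
  intro p₀ hp₀
  apply ContinuousAt.continuousWithinAt
  rw [Metric.continuousAt_iff']
  intro ε hε
  obtain ⟨d0, dz⟩ := hΔ p₀ hp₀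
  have sa := (props p₀ hp₀ 𝔞₀).1
  have up : ∀ᶠ p in 𝓝 p₀, Δ p < Δ p₀ + ε := by
    have h1 : pressure S.f p₀ 𝔞₀ (Δ p₀ + ε) < 0 := by
      rw [← dz]; exact sa d0 (by simp only [mem_Ici]; linarith) (by linarith)
    filter_upwards [(pc (Δ p₀ + ε) (by linarith) p₀ hp₀).eventually (gt_mem_nhds h1),
      S.P'_open.mem_nhds hp₀] with p h2 hp
    by_contra hcon
    push Not at hcon
    have := (props p hp 𝔞₀).1.antitoneOn (a := Δ p₀ + ε) (by simp only [mem_Ici]; linarith)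
      (hΔ p hp).1 hcon
    rw [(hΔ p hp).2] at this
    linarith
  have low : ∀ᶠ p in 𝓝 p₀, Δ p₀ - ε < Δ p := by
    by_cases hneg : Δ p₀ - ε < 0
    · filter_upwards [S.P'_open.mem_nhds hp₀] with p hp
      exact hneg.trans_le (hΔ p hp).1
    push Not at hneg
    have h1 : 0 < pressure S.f p₀ 𝔞₀ (Δ p₀ - ε) := by
      rw [← dz]; exact sa hneg d0 (by linarith)
    filter_upwards [(pc (Δ p₀ - ε) hneg p₀ hp₀).eventually (lt_mem_nhds h1),
      S.P'_open.mem_nhds hp₀] with p h2 hp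
    by_contra hcon
    push Not at hcon
    have := (props p hp 𝔞₀).1.antitoneOn (hΔ p hp).1 (b := Δ p₀ - ε) hneg hcon
    rw [(hΔ p hp).2] at this
    linarith
  filter_upwards [up, low] with p h1 h2
  rw [Real.dist_eq, abs_lt]
  constructor <;> linarith

end Paper
end
end

section
/- Let (F_p)_{p∈P} be a family of C^r-skew-products satisfying assumptions (U) and (T), with Δ(p) > N for every p in the closure of P. Set ε := (min_{p∈cl(P)} Δ(p) − N)/2 > 0 and η := −ε·log γ/(2N + ε). Fix p₀ ∈ P, 𝔞₀ ∈ 𝒜^ℕ, and δ > 0 small enough that δ < δ(η) (the constant given by the distortion lemma with respect to p) and that the ball B of center p₀ and radius δ is contained in P. Then there exists C' > 0 such that: (1) for every 𝔞 ∈ 𝒜^ℕ, n ≥ 0, ρ ∈ 𝒜^n, (α,β) ∈ C_ρ and r > 0: Leb_d{p ∈ B : ‖π_{p,𝔞}(α) − π_{p,𝔞}(β)‖ < r} ≤ C'·r^N·Λ_{p₀,𝔞₀,ρ}^{−N − 2ε/3}; and (2) there exists θ₀ > 0 such that for every parameterized family 𝔽 of θ₀-U-perturbations and every t ∈ T: Leb_d{p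 ∈ B : ‖π̃_{t,p,𝔞}(α) − π̃_{t,p,𝔞}(β)‖ < r} ≤ C'·r^N·Λ_{p₀,𝔞₀,ρ}^{−N − 2ε/3}. -/
open Filter MeasureTheory Set
open scoped Topology ENNReal NNReal

noncomputable section

namespace Paper


lemma cube_closed (N : ℕ) : IsClosed (cube N) := by
  have : cube N = ⋂ i, (fun x : E N => x i) ⁻¹' (Icc (-1:ℝ) 1) := by
    ext x; simp [cube]
  rw [this]
  refine isClosed_iInter fun i => IsClosed.preimage (by fun_prop) isClosed_Icc

lemma cubeO_closure_compact (d : ℕ) : IsCompact (closure (cubeO d)) := by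
  refine (cube_compact d).of_isClosed_subset isClosed_closure ?_
  refine closure_minimal ?_ (cube_closed d)
  intro x hx i
  exact ⟨(hx i).1.le, (hx i).2.le⟩

lemma dentry_sub_le {N : ℕ} (g h : E N → E N) (x y : E N) (i j : Fin N) :
    |dentry g x i j - dentry h y i j| ≤ ‖fderiv ℝ g x - fderiv ℝ h y‖ := by
  unfold dentry
  have h1 := (fderiv ℝ g x - fderiv ℝ h y).le_opNorm (EuclideanSpace.single j (1:ℝ))
  have h2 := EuclideanSpace.norm_eq ((fderiv ℝ g x - fderiv ℝ h y) (EuclideanSpace.single j (1:ℝ)))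
  have h3 := PiLp.norm_apply_le ((fderiv ℝ g x - fderiv ℝ h y) (EuclideanSpace.single j (1:ℝ))) i
  simp at h1 h3 ⊢
  linarith

lemma dentry_le {N : ℕ} (g : E N → E N) (x : E N) (i j : Fin N) :
    |dentry g x i j| ≤ ‖fderiv ℝ g x‖ := by
  unfold dentry
  have h1 := (fderiv ℝ g x).le_opNorm (EuclideanSpace.single j (1:ℝ))
  have h3 := PiLp.norm_apply_le ((fderiv ℝ g x) (EuclideanSpace.single j (1:ℝ))) i
  simp at h1 h3 ⊢
  linarith

lemma fderiv_apply_sum {N : ℕ} (L : E N →L[ℝ] E N) (v : E N) (i : Fin N) :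
    L v i = ∑ j, L (EuclideanSpace.single j (1:ℝ)) i * v j := by
  have hv : v = ∑ j, v j • EuclideanSpace.single j (1:ℝ) := by
    ext k
    simp [Finset.sum_apply, Pi.single_apply]
  conv_lhs => rw [hv]
  rw [map_sum]
  simp [mul_comm]

/-- weighted coordinates -/
def TW (N : ℕ) (s : ℝ) (v : E N) : Fin N → ℝ := fun i => s ^ (i : ℕ) * v i

lemma TW_sub {N : ℕ} (s : ℝ) (v w : E N) : TW N s (v - w) = TW N s v - TW N s w := by
  ext i; simp [TW, mul_sub]

lemma TW_norm_le {N : ℕ} {s : ℝ} (hs : 0 < s) (hs1 : s ≤ 1) (v : E N) : ‖TW N s v‖ ≤ ‖v‖ := by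
  refine (pi_norm_le_iff_of_nonneg (norm_nonneg _)).2 fun i => ?_
  have h3 := PiLp.norm_apply_le v i
  simp only [TW, norm_mul, norm_pow, Real.norm_eq_abs, abs_of_pos hs] at h3 ⊢
  have : s ^ (i:ℕ) ≤ 1 := pow_le_one₀ hs.le hs1
  nlinarith [abs_nonneg (v i)]

lemma TW_norm_cube {N : ℕ} {s : ℝ} (hs : 0 < s) (hs1 : s ≤ 1) {v : E N} (hv : v ∈ cube N) :
    ‖TW N s v‖ ≤ 1 := by
  refine (pi_norm_le_iff_of_nonneg zero_le_one).2 fun i => ?_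
  simp only [TW, norm_mul, norm_pow, Real.norm_eq_abs, abs_of_pos hs]
  have : s ^ (i:ℕ) ≤ 1 := pow_le_one₀ hs.le hs1
  have := abs_le.2 (hv i)
  nlinarith [abs_nonneg (v i)]

lemma norm_le_TW {N : ℕ} {s : ℝ} (hs : 0 < s) (hs1 : s ≤ 1) (v : E N) :
    ‖v‖ ≤ N * (s ^ N)⁻¹ * ‖TW N s v‖ := by
  have h1 : ‖v‖ ≤ ∑ j, ‖v j • EuclideanSpace.single j (1:ℝ)‖ := by
    have hv : v = ∑ j, v j • EuclideanSpace.single j (1:ℝ) := by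
      ext k
      simp [Finset.sum_apply, Pi.single_apply]
    conv_lhs => rw [hv]
    exact norm_sum_le _ _
  refine h1.trans ?_
  have : ∀ j : Fin N, ‖v j • EuclideanSpace.single j (1:ℝ)‖ ≤ (s ^ N)⁻¹ * ‖TW N s v‖ := by
    intro j
    have h2 := norm_le_pi_norm (TW N s v) j
    simp only [TW, norm_mul, norm_pow, Real.norm_eq_abs, abs_of_pos hs] at h2
    simp only [norm_smul, Real.norm_eq_abs, PiLp.norm_single, norm_one, mul_one]
    rw [inv_mul_eq_div, le_div_iff₀ (by positivity)]
    have h4 : s ^ N ≤ s ^ (j:ℕ) := pow_le_pow_of_le_one hs.le hs1 j.2.le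
    calc |v j| * s ^ N ≤ |v j| * s ^ (j:ℕ) := by gcongr
      _ ≤ _ := by rw [mul_comm]; exact h2
  calc _ ≤ ∑ j : Fin N, (s ^ N)⁻¹ * ‖TW N s v‖ := Finset.sum_le_sum fun j _ => this j
    _ = _ := by simp [mul_assoc]

lemma tri_core {N : ℕ} {s M : ℝ} (hs : 0 < s) (hs1 : s ≤ 1) (hM : 0 ≤ M) (J : Fin N → Fin N → ℝ)
    (u v : E N) (hu : ∀ i, u i = ∑ j, J i j * v j) (htri : ∀ i j : Fin N, (i:ℕ) < j → J i j = 0)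
    (hJ : ∀ i j, |J i j| ≤ M) (i : Fin N) :
    |s ^ (i:ℕ) * u i - J i i * (s ^ (i:ℕ) * v i)| ≤ N * M * s * ‖TW N s v‖ := by
  have e : s ^ (i:ℕ) * u i - J i i * (s ^ (i:ℕ) * v i)
      = ∑ j, (if j = i then 0 else s ^ (i:ℕ) * (J i j * v j)) := by
    rw [hu, Finset.mul_sum, ← Finset.add_sum_erase _ _ (Finset.mem_univ i),
      ← Finset.add_sum_erase (a := i) (f := fun j => (if j = i then 0 else s ^ (i:ℕ) * (J i j * v j)))
        _ (Finset.mem_univ i)]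
    have : ∑ x ∈ Finset.univ.erase i, s ^ (i:ℕ) * (J i x * v x)
      = ∑ j ∈ Finset.univ.erase i, (if j = i then 0 else s ^ (i:ℕ) * (J i j * v j)) := by
      refine Finset.sum_congr rfl fun j hj => ?_
      rw [if_neg (Finset.ne_of_mem_erase hj)]
    rw [this]; simp; ring
  rw [e]
  refine (Finset.abs_sum_le_sum_abs _ _).trans ?_
  have : ∀ j : Fin N, |(if j = i then 0 else s ^ (i:ℕ) * (J i j * v j))| ≤ M * s * ‖TW N s v‖ := by
    intro j
    split_ifs with h
    · simp; positivity
    · rcases lt_or_ge (i:ℕ) j with h1 | h1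
      · rw [htri i j h1]; simp; positivity
      · have h2 : (j:ℕ) + 1 ≤ i := by
          have : (j:ℕ) ≠ i := fun hh => h (Fin.ext hh)
          omega
        have h3 := norm_le_pi_norm (TW N s v) j
        simp only [TW, norm_mul, norm_pow, Real.norm_eq_abs, abs_of_pos hs] at h3
        have h4 : s ^ (i:ℕ) ≤ s ^ ((j:ℕ)+1) := pow_le_pow_of_le_one hs.le hs1 h2
        rw [abs_mul, abs_mul, abs_of_pos (pow_pos hs _)]
        calc s ^ (i:ℕ) * (|J i j| * |v j|) ≤ s ^ ((j:ℕ)+1) * (M * |v j|) := by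
              gcongr
              exact hJ i j
          _ = M * s * (s ^ (j:ℕ) * |v j|) := by ring
          _ ≤ M * s * ‖TW N s v‖ := by
              refine mul_le_mul_of_nonneg_left h3 (by positivity)
  calc _ ≤ ∑ j : Fin N, M * s * ‖TW N s v‖ := Finset.sum_le_sum fun j _ => this j
    _ = _ := by simp; ring

lemma tri_upper {N : ℕ} {s M m : ℝ} (hs : 0 < s) (hs1 : s ≤ 1) (hM : 0 ≤ M) (hm : 0 ≤ m)
    (J : Fin N → Fin N → ℝ)
    (u v : E N) (hu : ∀ i, u i = ∑ j, J i j * v j) (htri : ∀ i j : Fin N, (i:ℕ) < j → J i j = 0)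
    (hJ : ∀ i j, |J i j| ≤ M) (hd : ∀ i, |J i i| ≤ m) :
    ‖TW N s u‖ ≤ (m + N * M * s) * ‖TW N s v‖ := by
  refine (pi_norm_le_iff_of_nonneg (by positivity)).2 fun i => ?_
  have h := tri_core hs hs1 hM J u v hu htri hJ i
  have h3 := norm_le_pi_norm (TW N s v) i
  simp only [TW, Real.norm_eq_abs] at h3 ⊢
  have h4 : |J i i * (s ^ (i:ℕ) * v i)| ≤ m * ‖TW N s v‖ := by
    rw [abs_mul]
    exact mul_le_mul (hd i) h3 (abs_nonneg _) hm
  have h5 := abs_sub_abs_le_abs_sub (s ^ (i:ℕ) * u i) (J i i * (s ^ (i:ℕ) * v i))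
  linarith

lemma tri_lower {N : ℕ} (hN : 0 < N) {s M m : ℝ} (hs : 0 < s) (hs1 : s ≤ 1) (hM : 0 ≤ M)
    (J : Fin N → Fin N → ℝ)
    (u v : E N) (hu : ∀ i, u i = ∑ j, J i j * v j) (htri : ∀ i j : Fin N, (i:ℕ) < j → J i j = 0)
    (hJ : ∀ i j, |J i j| ≤ M) (hd : ∀ i, m ≤ |J i i|) :
    (m - N * M * s) * ‖TW N s v‖ ≤ ‖TW N s u‖ := by
  have : Nonempty (Fin N) := ⟨⟨0, hN⟩⟩
  obtain ⟨i, hi⟩ : ∃ i, ‖TW N s v‖ = ‖TW N s v i‖ := by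
    obtain ⟨i, -, hi⟩ := Finset.exists_max_image Finset.univ (fun i => ‖TW N s v i‖)
      Finset.univ_nonempty
    refine ⟨i, le_antisymm ?_ (norm_le_pi_norm _ i)⟩
    exact (pi_norm_le_iff_of_nonneg (norm_nonneg _)).2 fun j => hi j (Finset.mem_univ _)
  have h := tri_core hs hs1 hM J u v hu htri hJ i
  have h3 := norm_le_pi_norm (TW N s u) i
  have h4 : m * ‖TW N s v‖ ≤ |J i i * (s ^ (i:ℕ) * v i)| := by
    rw [abs_mul, hi]
    simp only [TW, Real.norm_eq_abs]
    exact mul_le_mul_of_nonneg_right (hd i) (abs_nonneg _)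
  simp only [TW, Real.norm_eq_abs] at h3
  have h5 := abs_sub_abs_le_abs_sub (J i i * (s ^ (i:ℕ) * v i)) (s ^ (i:ℕ) * u i)
  rw [abs_sub_comm] at h5
  linarith

/-- rowwise mean value theorem on the cube -/
lemma mvt_rows {N : ℕ} (g : E N → E N) (hg : ∀ x ∈ cube N, DifferentiableAt ℝ g x)
    {x y : E N} (hx : x ∈ cube N) (hy : y ∈ cube N) :
    ∃ z : Fin N → E N, (∀ i, z i ∈ segment ℝ x y) ∧
      ∀ i, (g x - g y) i = ∑ j, dentry g (z i) i j * (x - y) j := by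
  have key : ∀ i : Fin N, ∃ z ∈ segment ℝ x y,
      (g x - g y) i = ∑ j, dentry g z i j * (x - y) j := by
    intro i
    have := domain_mvt (f := fun x => g x i) (s := cube N) (x := y) (y := x)
      (f' := fun x => (EuclideanSpace.proj i : E N →L[ℝ] ℝ).comp (fderiv ℝ g x))
      (fun x hx => ((EuclideanSpace.proj i : E N →L[ℝ] ℝ).hasFDerivAt.comp x
        (hg x hx).hasFDerivAt).hasFDerivWithinAt) (cube_convex N) hy hx
    obtain ⟨z, hz, h⟩ := this
    refine ⟨z, by rwa [segment_symm], ?_⟩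
    have h2 := fderiv_apply_sum (fderiv ℝ g z) (x - y) i
    have h3 : g x i - g y i = fderiv ℝ g z (x - y) i := h
    rw [h2] at h3
    exact h3
  choose z hz h using key
  exact ⟨z, hz, h⟩

lemma TW_segment {N : ℕ} (s : ℝ) {x y z z' : E N} (hz : z ∈ segment ℝ x y) :
    ‖TW N s z - TW N s z'‖ ≤ ‖TW N s x - TW N s z'‖ + ‖TW N s x - TW N s y‖ := by
  obtain ⟨a, b, ha, hb, hab, rfl⟩ := hz
  have e : TW N s (a • x + b • y) - TW N s z'
      = (TW N s x - TW N s z') - b • (TW N s x - TW N s y) := by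
    ext i
    simp [TW]
    have : a = 1 - b := by linarith
    rw [this]; ring
  rw [e]
  refine (norm_sub_le _ _).trans ?_
  rw [norm_smul, Real.norm_eq_abs, abs_of_nonneg hb]
  have : b ≤ 1 := by linarith
  nlinarith [norm_nonneg (TW N s x - TW N s y)]

section unif
variable {A : Type} {N d : ℕ} {r : ℕ∞}

lemma partial_hasFDerivAt {F : E d × E N → E N} {p : E d} {x : E N}
    (h : DifferentiableAt ℝ F (p, x)) :
    HasFDerivAt (fun y => F (p, y)) ((fderiv ℝ F (p, x)).comp (ContinuousLinearMap.inr ℝ (E d) (E N))) x := by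
  have h1 : HasFDerivAt (fun y : E N => (p, y)) (ContinuousLinearMap.inr ℝ (E d) (E N)) x :=
    hasFDerivAt_prodMk_right p x
  exact h.hasFDerivAt.comp x h1

lemma inr_norm_le : ‖ContinuousLinearMap.inr ℝ (E d) (E N)‖ ≤ 1 := by
  refine ContinuousLinearMap.opNorm_le_bound _ zero_le_one fun y => ?_
  simp

lemma S_diffF (hr : 2 ≤ r) {P' : Set (E d)} {X' : Set (E N)} (hP : IsOpen P') (hX : IsOpen X')
    {F : E d × E N → E N} (hF : ContDiffOn ℝ r F (P' ×ˢ X')) {p : E d} (hp : p ∈ P')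
    {x : E N} (hx : x ∈ X') : DifferentiableAt ℝ F (p, x) := by
  have hr0 : ((r : ℕ∞) : WithTop ℕ∞) ≠ 0 := by
    have : r ≠ 0 := by rintro rfl; simp at hr
    exact_mod_cast this
  exact (hF.differentiableOn hr0).differentiableAt ((hP.prod hX).mem_nhds ⟨hp, hx⟩)

lemma S_fderiv_cont (hr : 2 ≤ r) (S : SkewFamily A N d r) (𝔞 : ℕ → A) :
    ContinuousOn (fun q : E d × E N => fderiv ℝ (S.f q.1 𝔞) q.2)
      (closure (cubeO d) ×ˢ cube N) := by
  have hr1 : (1 : WithTop ℕ∞) ≤ (r : WithTop ℕ∞) := by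
    have : (1 : ℕ∞) ≤ r := le_trans (by norm_num) hr
    exact_mod_cast this
  have h1 := (S.smooth 𝔞).continuousOn_fderiv_of_isOpen (S.P'_open.prod S.X'_open) hr1
  have h2 : ContinuousOn (fun q : E d × E N =>
      (fderiv ℝ (fun q : E d × E N => S.f q.1 𝔞 q.2) q).comp
        (ContinuousLinearMap.inr ℝ (E d) (E N))) (S.P' ×ˢ S.X') :=
    h1.clm_comp continuousOn_const
  refine (h2.mono (prod_mono S.P_subset S.X_subset)).congr ?_
  rintro ⟨p, x⟩ ⟨hp, hx⟩
  exact (partial_hasFDerivAt (S_diffF hr S.P'_open S.X'_open (S.smooth 𝔞) (S.P_subset hp)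
    (S.X_subset hx))).fderiv

lemma compact_K (d N : ℕ) : IsCompact (closure (cubeO d) ×ˢ cube N) :=
  (cubeO_closure_compact d).prod (cube_compact N)

/-- finitely many representatives -/
lemma finite_reps [Fintype A] [Nonempty A] (S : SkewFamily A N d r) {κ : ℝ} (hκ : 0 < κ) :
    ∃ (q : ℕ) (c : (Fin q → A) → (ℕ → A)), ∀ 𝔞 : ℕ → A, ∃ u, ∀ p ∈ closure (cubeO d),
      ∀ x ∈ cube N, ‖fderiv ℝ (S.f p 𝔞) x - fderiv ℝ (S.f p (c u)) x‖ ≤ κ := by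
  obtain ⟨C, hC, θ, hθ, h⟩ := S.holder1
  obtain ⟨q, hq⟩ := exists_pow_lt_of_lt_one (div_pos hκ hC) hθ.2
  refine ⟨q, fun u n => if hn : n < q then u ⟨n, hn⟩ else Classical.arbitrary A, fun 𝔞 =>
    ⟨fun i => 𝔞 i, fun p hp x hx => ?_⟩⟩
  refine (h p (S.P_subset hp) 𝔞 _ q (fun i hi => by simp [hi]) x (S.X_subset hx)).trans ?_
  rw [lt_div_iff₀ hC] at hq
  linarith

lemma S_bound [Fintype A] [Nonempty A] (hr : 2 ≤ r) (S : SkewFamily A N d r) :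
    ∃ M > (0:ℝ), ∀ p ∈ closure (cubeO d), ∀ 𝔞 : ℕ → A, ∀ x ∈ cube N,
      ‖fderiv ℝ (S.f p 𝔞) x‖ ≤ M := by
  obtain ⟨q, c, h⟩ := finite_reps S (zero_lt_one)
  have h1 : ∀ u, ∀ᶠ M : ℝ in atTop, ∀ p ∈ closure (cubeO d), ∀ x ∈ cube N,
      ‖fderiv ℝ (S.f p (c u)) x‖ ≤ M := by
    intro u
    obtain ⟨M, hM⟩ := (compact_K d N).exists_bound_of_continuousOn (S_fderiv_cont hr S (c u))
    filter_upwards [eventually_ge_atTop M] with M' hM' p hp x hx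
    exact (hM (p, x) ⟨hp, hx⟩).trans hM'
  obtain ⟨M, hM, hM0⟩ := ((eventually_all.2 h1).and (eventually_gt_atTop 0)).exists
  refine ⟨M + 1, by linarith, fun p hp 𝔞 x hx => ?_⟩
  obtain ⟨u, hu⟩ := h 𝔞
  have h2 := hu p hp x hx
  have h3 := hM u p hp x hx
  have h4 := norm_le_insert' (fderiv ℝ (S.f p 𝔞) x) (fderiv ℝ (S.f p (c u)) x)
  linarith

lemma S_modulus [Fintype A] [Nonempty A] (hr : 2 ≤ r) (S : SkewFamily A N d r)
    {κ : ℝ} (hκ : 0 < κ) :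
    ∃ K > (0:ℝ), ∀ p ∈ closure (cubeO d), ∀ 𝔞 : ℕ → A, ∀ x ∈ cube N, ∀ y ∈ cube N,
      ‖fderiv ℝ (S.f p 𝔞) x - fderiv ℝ (S.f p 𝔞) y‖ ≤ κ + K * ‖x - y‖ := by
  obtain ⟨q, c, h⟩ := finite_reps S (show 0 < κ / 3 by linarith)
  obtain ⟨M, hM0, hM⟩ := S_bound hr S
  have h1 : ∀ u, ∀ᶠ δ : ℝ in 𝓝[>] 0, ∀ p ∈ closure (cubeO d), ∀ x ∈ cube N, ∀ y ∈ cube N,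
      ‖x - y‖ < δ → ‖fderiv ℝ (S.f p (c u)) x - fderiv ℝ (S.f p (c u)) y‖ ≤ κ / 3 := by
    intro u
    have huc := (compact_K d N).uniformContinuousOn_of_continuous (S_fderiv_cont hr S (c u))
    rw [Metric.uniformContinuousOn_iff] at huc
    obtain ⟨δ, hδ, hh⟩ := huc (κ / 3) (by linarith)
    filter_upwards [Ioo_mem_nhdsGT hδ] with δ' hδ' p hp x hx y hy hxy
    have := hh (p, x) ⟨hp, hx⟩ (p, y) ⟨hp, hy⟩ (by
      rw [Prod.dist_eq]; simp only [dist_self, dist_eq_norm]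
      exact max_lt hδ (hxy.trans hδ'.2))
    rw [dist_eq_norm] at this
    exact this.le
  obtain ⟨δ, hδ, hδ0⟩ := ((eventually_all.2 h1).and self_mem_nhdsWithin).exists
  have hδ0 : 0 < δ := hδ0
  refine ⟨2 * M / δ, by positivity, fun p hp 𝔞 x hx y hy => ?_⟩
  rcases lt_or_ge ‖x - y‖ δ with hxy | hxy
  · obtain ⟨u, hu⟩ := h 𝔞
    have a1 := hu p hp x hx
    have a2 := hu p hp y hy
    have a3 := hδ u p hp x hx y hy hxy
    have a4 : 0 ≤ 2 * M / δ * ‖x - y‖ := by positivity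
    have a5 := norm_sub_le_norm_sub_add_norm_sub (fderiv ℝ (S.f p 𝔞) x)
      (fderiv ℝ (S.f p (c u)) x) (fderiv ℝ (S.f p 𝔞) y)
    have a6 := norm_sub_le_norm_sub_add_norm_sub (fderiv ℝ (S.f p (c u)) x)
      (fderiv ℝ (S.f p (c u)) y) (fderiv ℝ (S.f p 𝔞) y)
    rw [norm_sub_rev] at a2
    linarith
  · have a1 := hM p hp 𝔞 x hx
    have a2 := hM p hp 𝔞 y hy
    have a3 := norm_sub_le (fderiv ℝ (S.f p 𝔞) x) (fderiv ℝ (S.f p 𝔞) y)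
    have a4 : 2 * M ≤ 2 * M / δ * ‖x - y‖ := by
      rw [div_mul_eq_mul_div, le_div_iff₀ hδ0]
      gcongr
    linarith

end unif

section dyn
variable {A : Type} {N d : ℕ}

lemma consF_agree {a : A} {𝔞 𝔟 : ℕ → A} {q : ℕ} (h : ∀ i < q, 𝔞 i = 𝔟 i) :
    ∀ i < q + 1, consF a 𝔞 i = consF a 𝔟 i := by
  intro i hi
  cases i with
  | zero => rfl
  | succ k => exact h k (by omega)

lemma psi_mem {g : E d → (ℕ → A) → E N → E N} {p : E d}
    (h : ∀ 𝔞, ∀ x ∈ cube N, g p 𝔞 x ∈ cube N) (w : List A) :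
    ∀ 𝔞, ∀ x ∈ cube N, psi g p w 𝔞 x ∈ cube N := by
  induction w with
  | nil => intro 𝔞 x hx; exact hx
  | cons a w ih => intro 𝔞 x hx; exact h _ _ (ih _ x hx)

lemma psi_diff {g : E d → (ℕ → A) → E N → E N} {p : E d}
    (h : ∀ 𝔞, ∀ x ∈ cube N, g p 𝔞 x ∈ cube N)
    (hd : ∀ 𝔞, ∀ x ∈ cube N, DifferentiableAt ℝ (g p 𝔞) x) (w : List A) :
    ∀ 𝔞, ∀ x ∈ cube N, DifferentiableAt ℝ (psi g p w 𝔞) x := by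
  induction w with
  | nil => intro 𝔞 x hx; exact differentiableAt_id
  | cons a w ih =>
    intro 𝔞 x hx
    exact (hd _ _ (psi_mem h w _ x hx)).comp x (ih _ x hx)

lemma lam_nil (hN : 0 < N) (f : E d → (ℕ → A) → E N → E N) (p : E d) (𝔞 : ℕ → A) (x : E N) :
    lam hN f p 𝔞 [] x = 1 := by
  simp [lam, dentry, psi]

lemma lam_cons (hN : 0 < N) {f : E d → (ℕ → A) → E N → E N} {p : E d}
    (h : ∀ 𝔞, ∀ x ∈ cube N, f p 𝔞 x ∈ cube N)
    (hd : ∀ 𝔞, ∀ x ∈ cube N, DifferentiableAt ℝ (f p 𝔞) x)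
    (ht : ∀ 𝔞, ∀ x ∈ cube N, ∀ j : Fin N, 0 < (j:ℕ) → dentry (f p 𝔞) x ⟨0, hN⟩ j = 0)
    (a : A) (w : List A) (𝔞 : ℕ → A) {x : E N} (hx : x ∈ cube N) :
    lam hN f p 𝔞 (a :: w) x =
      |dentry (f p (consF a 𝔞)) (psi f p w (consF a 𝔞) x) ⟨0, hN⟩ ⟨0, hN⟩|
        * lam hN f p (consF a 𝔞) w x := by
  unfold lam
  rw [← abs_mul]
  congr 1
  have h1 := hd (consF a 𝔞) _ (psi_mem h w (consF a 𝔞) x hx)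
  have h2 := psi_diff h hd w (consF a 𝔞) x hx
  have e : dentry (psi f p (a :: w) 𝔞) x ⟨0, hN⟩ ⟨0, hN⟩ =
      fderiv ℝ (f p (consF a 𝔞)) (psi f p w (consF a 𝔞) x)
        (fderiv ℝ (psi f p w (consF a 𝔞)) x (EuclideanSpace.single ⟨0, hN⟩ (1:ℝ))) ⟨0, hN⟩ := by
    unfold dentry
    simp only [psi]
    rw [fderiv_comp x h1 h2]
    rfl
  rw [e, fderiv_apply_sum, Finset.sum_eq_single ⟨0, hN⟩]
  · rfl
  · intro j _ hj
    have : dentry (f p (consF a 𝔞)) (psi f p w (consF a 𝔞) x) ⟨0, hN⟩ j = 0 := by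
      refine ht _ _ (psi_mem h w _ x hx) j ?_
      rcases Nat.eq_zero_or_pos (j:ℕ) with h0 | h0
      · exact absurd (Fin.ext h0) hj
      · exact h0
    unfold dentry at this
    rw [this, zero_mul]
  · simp

lemma lam_nonneg (hN : 0 < N) (f : E d → (ℕ → A) → E N → E N) (p : E d) (𝔞 : ℕ → A)
    (w : List A) (x : E N) : 0 ≤ lam hN f p 𝔞 w x := abs_nonneg _

/-- one-step control of a family `g` against a reference family `f` at the parameter `p` -/
structure Good_s15 (hN : 0 < N) (f g : E d → (ℕ → A) → E N → E N) (p : E d)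
    (s γ₂ κ K C ϑ θ₀ : ℝ) : Prop where
  intoF : ∀ 𝔞, ∀ x ∈ cube N, f p 𝔞 x ∈ cube N
  intoG : ∀ 𝔞, ∀ x ∈ cube N, g p 𝔞 x ∈ cube N
  diffF : ∀ 𝔞, ∀ x ∈ cube N, DifferentiableAt ℝ (f p 𝔞) x
  diffG : ∀ 𝔞, ∀ x ∈ cube N, DifferentiableAt ℝ (g p 𝔞) x
  tri : ∀ 𝔞, ∀ x ∈ cube N, ∀ j : Fin N, 0 < (j:ℕ) → dentry (f p 𝔞) x ⟨0, hN⟩ j = 0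
  contr : ∀ 𝔞, ∀ x ∈ cube N, ∀ y ∈ cube N,
    ‖TW N s (g p 𝔞 x) - TW N s (g p 𝔞 y)‖ ≤ γ₂ * ‖TW N s x - TW N s y‖
  lower : ∀ (𝔞 𝔟 : ℕ → A) (q : ℕ), (∀ i < q, 𝔞 i = 𝔟 i) → ∀ x ∈ cube N, ∀ y ∈ cube N,
    ∀ z ∈ cube N, |dentry (f p 𝔟) z ⟨0, hN⟩ ⟨0, hN⟩| * ‖TW N s x - TW N s y‖ ≤
      Real.exp (κ + K * (‖TW N s x - TW N s z‖ + ‖TW N s x - TW N s y‖ + ϑ ^ q)) *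
        ‖TW N s (g p 𝔞 x) - TW N s (g p 𝔞 y)‖
  cross : ∀ (𝔞 𝔟 : ℕ → A) (q : ℕ), (∀ i < q, 𝔞 i = 𝔟 i) → ∀ x ∈ cube N,
    ‖TW N s (g p 𝔞 x) - TW N s (f p 𝔟 x)‖ ≤ C * ϑ ^ q + θ₀

variable {hN : 0 < N} {f g : E d → (ℕ → A) → E N → E N} {p : E d} {s γ₂ κ K C ϑ θ₀ : ℝ}

lemma main_ind (hs : 0 < s) (hs1 : s ≤ 1) (hγ0 : 0 ≤ γ₂) (hγ1 : γ₂ < 1) (hϑ0 : 0 < ϑ) (hϑ1 : ϑ < 1)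
    (hC : 0 ≤ C) (H : Good_s15 hN f g p s γ₂ κ K C ϑ θ₀) (w : List A) :
    ∀ (𝔞 𝔟 : ℕ → A) (q : ℕ), (∀ i < q, 𝔞 i = 𝔟 i) → ∀ x ∈ cube N, ∀ y ∈ cube N, ∀ z ∈ cube N,
    ∃ B : ℝ, B + (1 - γ₂)⁻¹ * (‖TW N s (psi g p w 𝔞 x) - TW N s (psi f p w 𝔟 z)‖
          + ‖TW N s (psi g p w 𝔞 x) - TW N s (psi g p w 𝔞 y)‖)
        ≤ 4 * (1 - γ₂)⁻¹ + (1 + (1 - γ₂)⁻¹ * C) * ϑ / (1 - ϑ) * ϑ ^ q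
          + (1 - γ₂)⁻¹ * w.length * θ₀ ∧
      lam hN f p 𝔟 w z * ‖TW N s x - TW N s y‖ ≤ Real.exp (κ * w.length + K * B) *
        ‖TW N s (psi g p w 𝔞 x) - TW N s (psi g p w 𝔞 y)‖ := by
  have hc : 0 < (1 - γ₂)⁻¹ := inv_pos.2 (by linarith)
  set c := (1 - γ₂)⁻¹ with hcdef
  have hcγ : 1 + c * γ₂ = c := by
    have : c * (1 - γ₂) = 1 := inv_mul_cancel₀ (by linarith)
    linarith
  have hϑ2 : 0 < 1 - ϑ := by linarith
  set c2 := (1 + c * C) * ϑ / (1 - ϑ) with hc2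
  have hc2e : c2 * (1 - ϑ) = (1 + c * C) * ϑ := div_mul_cancel₀ _ hϑ2.ne'
  have hc20 : 0 ≤ c2 := by positivity
  induction w with
  | nil =>
    intro 𝔞 𝔟 q hq x hx y hy z hz
    refine ⟨0, ?_, ?_⟩
    · have a1 := TW_norm_cube hs hs1 hx
      have a2 := TW_norm_cube hs hs1 hy
      have a3 := TW_norm_cube hs hs1 hz
      have a4 := norm_sub_le (TW N s x) (TW N s z)
      have a5 := norm_sub_le (TW N s x) (TW N s y)
      have a6 : c * (‖TW N s x - TW N s z‖ + ‖TW N s x - TW N s y‖) ≤ c * 4 := by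
        gcongr; linarith
      have a7 : 0 ≤ c2 * ϑ ^ q := by positivity
      simp only [psi, id, List.length_nil, Nat.cast_zero]
      linarith
    · simp [lam_nil, psi]
  | cons a w ih =>
    intro 𝔞 𝔟 q hq x hx y hy z hz
    have hq1 := consF_agree (a := a) hq
    obtain ⟨B, hB1, hB2⟩ := ih (consF a 𝔞) (consF a 𝔟) (q+1) hq1 x hx y hy z hz
    have mx := psi_mem H.intoG w (consF a 𝔞) x hx
    have my := psi_mem H.intoG w (consF a 𝔞) y hy
    have mz := psi_mem H.intoF w (consF a 𝔟) z hz
    rw [lam_cons hN H.intoF H.diffF H.tri a w 𝔟 hz]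
    have e1 : ∀ x, psi g p (a :: w) 𝔞 x = g p (consF a 𝔞) (psi g p w (consF a 𝔞) x) := fun x => rfl
    have e2 : ∀ x, psi f p (a :: w) 𝔟 x = f p (consF a 𝔟) (psi f p w (consF a 𝔟) x) := fun x => rfl
    rw [e1, e1, e2]
    set X := psi g p w (consF a 𝔞) x
    set Y := psi g p w (consF a 𝔞) y
    set Z := psi f p w (consF a 𝔟) z
    have b1 := H.contr (consF a 𝔞) X mx Y my
    have b2 := H.contr (consF a 𝔞) X mx Z mz
    have b3 := H.cross (consF a 𝔞) (consF a 𝔟) (q+1) hq1 Z mz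
    have b4 := H.lower (consF a 𝔞) (consF a 𝔟) (q+1) hq1 X mx Y my Z mz
    have b5 := norm_sub_le_norm_sub_add_norm_sub (TW N s (g p (consF a 𝔞) X))
      (TW N s (g p (consF a 𝔞) Z)) (TW N s (f p (consF a 𝔟) Z))
    refine ⟨B + (‖TW N s X - TW N s Z‖ + ‖TW N s X - TW N s Y‖ + ϑ ^ (q+1)), ?_, ?_⟩
    · set D := ‖TW N s X - TW N s Z‖ + ‖TW N s X - TW N s Y‖ with hD
      have b6 : c * (‖TW N s (g p (consF a 𝔞) X) - TW N s (f p (consF a 𝔟) Z)‖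
          + ‖TW N s (g p (consF a 𝔞) X) - TW N s (g p (consF a 𝔞) Y)‖)
          ≤ c * (γ₂ * D + C * ϑ ^ (q+1) + θ₀) := by
        refine mul_le_mul_of_nonneg_left ?_ hc.le
        rw [hD]; linarith
      have b7 : c2 * ϑ ^ q = c2 * ϑ ^ (q+1) + (1 + c * C) * ϑ ^ (q+1) := by
        have : c2 = c2 * ϑ + (1 + c * C) * ϑ := by linarith
        calc c2 * ϑ ^ q = (c2 * ϑ + (1 + c * C) * ϑ) * ϑ ^ q := by rw [← this]
          _ = _ := by ring
      have b8 : c * D = D + c * γ₂ * D := by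
        calc c * D = (1 + c * γ₂) * D := by rw [hcγ]
          _ = _ := by ring
      rw [b7]
      push_cast [List.length_cons]
      nlinarith
    · set G := ‖TW N s (g p (consF a 𝔞) X) - TW N s (g p (consF a 𝔞) Y)‖
      have hl := lam_nonneg hN f p (consF a 𝔟) w z
      calc _ = |dentry (f p (consF a 𝔟)) Z ⟨0, hN⟩ ⟨0, hN⟩| *
            (lam hN f p (consF a 𝔟) w z * ‖TW N s x - TW N s y‖) := by ring
        _ ≤ |dentry (f p (consF a 𝔟)) Z ⟨0, hN⟩ ⟨0, hN⟩| *
            (Real.exp (κ * w.length + K * B) * ‖TW N s X - TW N s Y‖) := by gcongr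
        _ = Real.exp (κ * w.length + K * B) *
            (|dentry (f p (consF a 𝔟)) Z ⟨0, hN⟩ ⟨0, hN⟩| * ‖TW N s X - TW N s Y‖) := by ring
        _ ≤ Real.exp (κ * w.length + K * B) * (Real.exp _ * G) := by gcongr
        _ = _ := by
          rw [← mul_assoc, ← Real.exp_add]
          congr 2
          push_cast [List.length_cons]
          ring

lemma psi_contr (hγ0 : 0 ≤ γ₂) (H : Good_s15 hN f g p s γ₂ κ K C ϑ θ₀) (w : List A) :
    ∀ 𝔞, ∀ x ∈ cube N, ∀ y ∈ cube N,
    ‖TW N s (psi g p w 𝔞 x) - TW N s (psi g p w 𝔞 y)‖ ≤ γ₂ ^ w.length * ‖TW N s x - TW N s y‖ := by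
  induction w with
  | nil => intro 𝔞 x hx y hy; simp [psi]
  | cons a w ih =>
    intro 𝔞 x hx y hy
    refine (H.contr _ _ (psi_mem H.intoG w _ x hx) _ (psi_mem H.intoG w _ y hy)).trans ?_
    have := ih (consF a 𝔞) x hx y hy
    calc _ ≤ γ₂ * (γ₂ ^ w.length * ‖TW N s x - TW N s y‖) := by gcongr
      _ = _ := by rw [List.length_cons]; ring

lemma psi_append (g : E d → (ℕ → A) → E N → E N) (p : E d) (u v : List A) :
    ∀ (𝔞 : ℕ → A) (x : E N), psi g p (u ++ v) 𝔞 x = psi g p u 𝔞 (psi g p v (app u 𝔞) x) := by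
  induction u with
  | nil => intro 𝔞 x; rfl
  | cons a u ih =>
    intro 𝔞 x
    change g p (consF a 𝔞) (psi g p (u ++ v) (consF a 𝔞) x) = _
    rw [ih]; rfl

lemma trunc_add (α : ℕ → A) (n m : ℕ) :
    trunc α (n + m) = trunc α n ++ trunc (fun k => α (n + k)) m := by
  apply List.ext_getElem
  · simp [trunc]
  · intro i h1 h2
    simp only [trunc, List.getElem_ofFn, List.getElem_append, List.length_ofFn]
    split_ifs with h
    · rfl
    · congr 1; omega

lemma trunc_word (α : ℕ → A) (w : List A) (h : ∀ i : Fin w.length, α i = w.get i) :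
    trunc α w.length = w := by
  apply List.ext_getElem
  · simp [trunc]
  · intro i h1 h2
    simpa [trunc] using h ⟨i, h2⟩

lemma pi_tendsto (hs : 0 < s) (hs1 : s ≤ 1) (hγ0 : 0 ≤ γ₂) (hγ1 : γ₂ < 1)
    (H : Good_s15 hN f g p s γ₂ κ K C ϑ θ₀) (𝔞 α : ℕ → A) :
    Tendsto (fun n => psi g p (trunc α n) 𝔞 0) atTop (𝓝 (piProj g p 𝔞 α)) := by
  refine tendsto_nhds_limUnder ?_
  refine cauchySeq_tendsto_of_complete ?_
  refine cauchySeq_of_le_geometric γ₂ (N * (s ^ N)⁻¹ * 2) hγ1 fun n => ?_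
  rw [dist_eq_norm]
  refine (norm_le_TW hs hs1 _).trans ?_
  rw [TW_sub, trunc_add, psi_append, mul_assoc, mul_assoc]
  have m2 := psi_mem H.intoG (trunc (fun k => α (n + k)) 1) (app (trunc α n) 𝔞) 0 (zero_mem_cube N)
  have h1 := psi_contr hγ0 H (trunc α n) 𝔞 0 (zero_mem_cube N) _ m2
  have h2 : (trunc α n).length = n := by simp [trunc]
  rw [h2] at h1
  have a2 := TW_norm_cube hs hs1 (zero_mem_cube N)
  have a3 := TW_norm_cube hs hs1 m2
  have a4 := (norm_sub_le (TW N s 0) (TW N s (psi g p (trunc (fun k => α (n + k)) 1) (app (trunc α n) 𝔞) 0)))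
  rw [← mul_assoc, ← mul_assoc]
  have h3 : ‖TW N s (psi g p (trunc α n) 𝔞 0) - TW N s (psi g p (trunc α n) 𝔞
      (psi g p (trunc (fun k => α (n + k)) 1) (app (trunc α n) 𝔞) 0))‖ ≤ γ₂ ^ n * 2 := by
    refine h1.trans ?_
    gcongr
    linarith
  calc _ ≤ N * (s ^ N)⁻¹ * (γ₂ ^ n * 2) := by gcongr
    _ = _ := by ring

lemma pi_mem (hs : 0 < s) (hs1 : s ≤ 1) (hγ0 : 0 ≤ γ₂) (hγ1 : γ₂ < 1)
    (H : Good_s15 hN f g p s γ₂ κ K C ϑ θ₀) (𝔞 α : ℕ → A) : piProj g p 𝔞 α ∈ cube N :=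
  (cube_closed N).mem_of_tendsto (pi_tendsto hs hs1 hγ0 hγ1 H 𝔞 α)
    (Eventually.of_forall fun _ => psi_mem H.intoG _ _ _ (zero_mem_cube N))

lemma pi_shift (hs : 0 < s) (hs1 : s ≤ 1) (hγ0 : 0 ≤ γ₂) (hγ1 : γ₂ < 1)
    (H : Good_s15 hN f g p s γ₂ κ K C ϑ θ₀) (𝔞 α : ℕ → A) (w : List A)
    (h : ∀ i : Fin w.length, α i = w.get i) :
    piProj g p 𝔞 α = psi g p w 𝔞 (piProj g p (app w 𝔞) (fun k => α (w.length + k))) := by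
  have h1 := pi_tendsto hs hs1 hγ0 hγ1 H (app w 𝔞) (fun k => α (w.length + k))
  have h2 := ((psi_diff H.intoG H.diffG w 𝔞 _
    (pi_mem hs hs1 hγ0 hγ1 H (app w 𝔞) (fun k => α (w.length + k)))).continuousAt.tendsto).comp h1
  have h3 := (pi_tendsto hs hs1 hγ0 hγ1 H 𝔞 α).comp (tendsto_add_atTop_nat w.length)
  refine tendsto_nhds_unique h3 (h2.congr fun n => ?_)
  simp only [Function.comp]
  rw [add_comm n, trunc_add, trunc_word α w h, psi_append]

lemma exp_bound (hs : 0 < s) (hs1 : s ≤ 1) (hγ0 : 0 ≤ γ₂) (hγ1 : γ₂ < 1) (hϑ0 : 0 < ϑ) (hϑ1 : ϑ < 1)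
    (hC : 0 ≤ C) (hK : 0 ≤ K) (H : Good_s15 hN f g p s γ₂ κ K C ϑ θ₀) (w : List A)
    (𝔞 𝔟 : ℕ → A) {x y : E N} (hx : x ∈ cube N) (hy : y ∈ cube N) :
    Lam hN f p 𝔟 w * ‖x - y‖ ≤ N * (s ^ N)⁻¹ *
      (Real.exp (K * (4 * (1 - γ₂)⁻¹ + (1 + (1 - γ₂)⁻¹ * C) * ϑ / (1 - ϑ))) *
      Real.exp ((κ + K * (1 - γ₂)⁻¹ * θ₀) * w.length) *
        ‖psi g p w 𝔞 x - psi g p w 𝔞 y‖) := by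
  have hc : 0 < (1 - γ₂)⁻¹ := inv_pos.2 (by linarith)
  set R := Real.exp (K * (4 * (1 - γ₂)⁻¹ + (1 + (1 - γ₂)⁻¹ * C) * ϑ / (1 - ϑ))) *
      Real.exp ((κ + K * (1 - γ₂)⁻¹ * θ₀) * w.length) *
        ‖psi g p w 𝔞 x - psi g p w 𝔞 y‖ with hR
  have h1 : ∀ z ∈ cube N, lam hN f p 𝔟 w z * ‖TW N s x - TW N s y‖ ≤ R := by
    intro z hz
    obtain ⟨B, hB1, hB2⟩ := main_ind hs hs1 hγ0 hγ1 hϑ0 hϑ1 hC H w 𝔞 𝔟 0 (by simp) x hx y hy z hz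
    refine hB2.trans ?_
    rw [hR, ← Real.exp_add, ← TW_sub]
    have hB3 : B ≤ 4 * (1 - γ₂)⁻¹ + (1 + (1 - γ₂)⁻¹ * C) * ϑ / (1 - ϑ)
        + (1 - γ₂)⁻¹ * w.length * θ₀ := by
      rw [pow_zero, mul_one] at hB1
      refine le_trans ?_ hB1
      have : 0 ≤ (1 - γ₂)⁻¹ * (‖TW N s (psi g p w 𝔞 x) - TW N s (psi f p w 𝔟 z)‖
          + ‖TW N s (psi g p w 𝔞 x) - TW N s (psi g p w 𝔞 y)‖) := by positivity
      linarith
    have hB4 := mul_le_mul_of_nonneg_left hB3 hK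
    refine mul_le_mul (Real.exp_le_exp.2 ?_) (TW_norm_le hs hs1 _) (norm_nonneg _)
      (Real.exp_pos _).le
    linarith
  have h2 : ∀ z ∈ cube N, lam hN f p 𝔟 w z * ‖x - y‖ ≤ N * (s ^ N)⁻¹ * R := by
    intro z hz
    have := norm_le_TW hs hs1 (x - y)
    rw [TW_sub] at this
    calc lam hN f p 𝔟 w z * ‖x - y‖
        ≤ lam hN f p 𝔟 w z * (N * (s ^ N)⁻¹ * ‖TW N s x - TW N s y‖) := by
          gcongr; exact lam_nonneg _ _ _ _ _ _
      _ = N * (s ^ N)⁻¹ * (lam hN f p 𝔟 w z * ‖TW N s x - TW N s y‖) := by ring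
      _ ≤ _ := by gcongr; exact h1 z hz
  rcases (norm_nonneg (x - y)).eq_or_lt with h0 | h0
  · rw [← h0, mul_zero]; positivity
  rw [← le_div_iff₀ h0]
  refine csSup_le ⟨_, mem_image_of_mem _ (zero_mem_cube N)⟩ ?_
  rintro _ ⟨z, hz, rfl⟩
  rw [le_div_iff₀ h0]
  exact h2 z hz

end dyn

section final
variable {A : Type} {N d : ℕ} {r : ℕ∞}

/-- `g` is `C¹`-close to `f` at the parameter `p` -/
structure CloseAt (f g : E d → (ℕ → A) → E N → E N) (p : E d) (θ : ℝ) : Prop where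
  into : ∀ 𝔞, ∀ x ∈ cube N, g p 𝔞 x ∈ cube N
  diff : ∀ 𝔞, ∀ x ∈ cube N, DifferentiableAt ℝ (g p 𝔞) x
  tri : ∀ 𝔞, ∀ x ∈ cube N, ∀ i j : Fin N, (i : ℕ) < (j : ℕ) → dentry (g p 𝔞) x i j = 0
  c0 : ∀ 𝔞, ∀ x ∈ cube N, ‖g p 𝔞 x - f p 𝔞 x‖ ≤ θ
  c1 : ∀ 𝔞, ∀ x ∈ cube N, ‖fderiv ℝ (g p 𝔞) x - fderiv ℝ (f p 𝔞) x‖ ≤ θ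

lemma gamma_bd {hN : 0 < N} {f : E d → (ℕ → A) → E N → E N} {γ' γ : ℝ}
    (hγ : GammaBounds hN f γ' γ) {p : E d} (hp : p ∈ closure (cubeO d)) (𝔞 : ℕ → A)
    {x : E N} (hx : x ∈ cube N) :
    γ' < |dentry (f p 𝔞) x ⟨0, hN⟩ ⟨0, hN⟩| ∧ |dentry (f p 𝔞) x ⟨0, hN⟩ ⟨0, hN⟩| < γ := by
  have h := hγ.2.2.2 p hp (fun n => 𝔞 (n+1)) (𝔞 0) x hx
  have e : consF (𝔞 0) (fun n => 𝔞 (n+1)) = 𝔞 := by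
    funext n; cases n <;> rfl
  simpa only [lam, psi, Function.comp_id, e] using h

lemma good_exists [Fintype A] [Nonempty A] (hN : 0 < N) (hr : 2 ≤ r) (S : SkewFamily A N d r)
    (hU : UnipOn hN S.f S.P' S.X') {γ' γ : ℝ} (hγ : GammaBounds hN S.f γ' γ) {κ : ℝ} (hκ : 0 < κ) :
    ∃ s γ₂ K C ϑ θ₁ : ℝ, 0 < s ∧ s ≤ 1 ∧ 0 ≤ γ₂ ∧ γ₂ < 1 ∧ 0 ≤ K ∧ 0 ≤ C ∧ 0 < ϑ ∧ ϑ < 1 ∧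
      0 < θ₁ ∧ K * (1 - γ₂)⁻¹ * θ₁ ≤ κ ∧
      ∀ (g : E d → (ℕ → A) → E N → E N), ∀ p ∈ closure (cubeO d), CloseAt S.f g p θ₁ →
        Good_s15 hN S.f g p s γ₂ κ K C ϑ θ₁ := by
  obtain ⟨hγ'0, hγ'γ, hγ1, -⟩ := id hγ
  obtain ⟨C0, hC0, ϑ0, hϑ0, hh0⟩ := S.holder0
  obtain ⟨C1, hC1, ϑ1, hϑ1, hh1⟩ := S.holder1
  obtain ⟨Mf, hMf0, hMf⟩ := S_bound hr S
  set ϑ := max ϑ0 ϑ1 with hϑ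
  have hϑpos : 0 < ϑ := lt_max_of_lt_left hϑ0.1
  have hϑlt : ϑ < 1 := max_lt hϑ0.2 hϑ1.2
  set κ1 := min (κ * γ' / 6) (min (γ' / 4) ((1 - γ) / 4)) with hκ1
  have hκ1pos : 0 < κ1 := by
    refine lt_min (by positivity) (lt_min (by positivity) (by linarith))
  have k1 : κ1 ≤ κ * γ' / 6 := min_le_left _ _
  have k2 : κ1 ≤ γ' / 4 := (min_le_right _ _).trans (min_le_left _ _)
  have k3 : κ1 ≤ (1 - γ) / 4 := (min_le_right _ _).trans (min_le_right _ _)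
  set M := Mf + 1 with hM
  have hMpos : 0 < M := by linarith
  have hNpos : (0:ℝ) < N := by exact_mod_cast hN
  set s := min 1 (κ1 / (N * M)) with hsdef
  have hs : 0 < s := lt_min one_pos (by positivity)
  have hs1 : s ≤ 1 := min_le_left _ _
  have hNMs : N * M * s ≤ κ1 := by
    have : s ≤ κ1 / (N * M) := min_le_right _ _
    rw [le_div_iff₀ (by positivity)] at this
    linarith
  have hNMs0 : 0 ≤ N * M * s := by positivity
  obtain ⟨K1, hK1, hmod⟩ := S_modulus hr S hκ1pos
  set L := N * (s ^ N)⁻¹ with hL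
  have hLpos : 0 < L := by positivity
  set K2 := K1 * L + C1 with hK2
  have hK2pos : 0 < K2 := by positivity
  set K := 2 * K2 / γ' with hKd
  have hKpos : 0 < K := by positivity
  set γ₂ := γ + 2 * κ1 with hγ₂
  have hγ₂1 : γ₂ < 1 := by linarith
  have hc : 0 < (1 - γ₂)⁻¹ := inv_pos.2 (by linarith)
  set θ₁ := min (min 1 κ1) (κ / (K * (1 - γ₂)⁻¹)) with hθ₁
  have hθpos : 0 < θ₁ := lt_min (lt_min one_pos hκ1pos) (by positivity)
  have t1 : θ₁ ≤ 1 := (min_le_left _ _).trans (min_le_left _ _)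
  have t2 : θ₁ ≤ κ1 := (min_le_left _ _).trans (min_le_right _ _)
  have t3 : K * (1 - γ₂)⁻¹ * θ₁ ≤ κ := by
    have : θ₁ ≤ κ / (K * (1 - γ₂)⁻¹) := min_le_right _ _
    rw [le_div_iff₀ (by positivity)] at this
    linarith
  refine ⟨s, γ₂, K, C0, ϑ, θ₁, hs, hs1, by linarith, hγ₂1, hKpos.le, hC0.le, hϑpos, hϑlt, hθpos,
    t3, fun g p hp hg => ?_⟩
  have hp' := S.P_subset hp
  have pow0 : ∀ q : ℕ, ϑ0 ^ q ≤ ϑ ^ q := fun q => pow_le_pow_left₀ hϑ0.1.le (le_max_left _ _) q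
  have pow1 : ∀ q : ℕ, ϑ1 ^ q ≤ ϑ ^ q := fun q => pow_le_pow_left₀ hϑ1.1.le (le_max_right _ _) q
  -- entries of `g`
  have gM : ∀ 𝔞, ∀ x ∈ cube N, ∀ i j, |dentry (g p 𝔞) x i j| ≤ M := by
    intro 𝔞 x hx i j
    have a1 := hg.c1 𝔞 x hx
    have a2 := hMf p hp 𝔞 x hx
    have a3 := norm_le_insert' (fderiv ℝ (g p 𝔞) x) (fderiv ℝ (S.f p 𝔞) x)
    have a4 := dentry_le (g p 𝔞) x i j
    linarith
  have gdiag : ∀ 𝔞, ∀ x ∈ cube N, ∀ i,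
      |(|dentry (g p 𝔞) x i i| - |dentry (S.f p 𝔞) x ⟨0, hN⟩ ⟨0, hN⟩|)| ≤ θ₁ := by
    intro 𝔞 x hx i
    have a1 := hg.c1 𝔞 x hx
    have a2 := dentry_sub_le (g p 𝔞) (S.f p 𝔞) x x i i
    have a3 := (hU p hp' 𝔞 x (S.X_subset hx)).2.1 i ⟨0, hN⟩
    have a4 := abs_abs_sub_abs_le (dentry (g p 𝔞) x i i) (dentry (S.f p 𝔞) x i i)
    rw [← a3]
    linarith
  refine ⟨?_, hg.into, ?_, hg.diff, ?_, ?_, ?_, ?_⟩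
  · intro 𝔞 x hx
    exact S.into 𝔞 p hp' (mem_image_of_mem _ (S.X_subset hx))
  · intro 𝔞 x hx
    exact (partial_hasFDerivAt (F := fun q : E d × E N => S.f q.1 𝔞 q.2)
      (S_diffF hr S.P'_open S.X'_open (S.smooth 𝔞) hp' (S.X_subset hx))).differentiableAt
  · intro 𝔞 x hx j hj
    exact (hU p hp' 𝔞 x (S.X_subset hx)).1 ⟨0, hN⟩ j hj
  · intro 𝔞 x hx y hy
    obtain ⟨z, hz, hrow⟩ := mvt_rows (g p 𝔞) (hg.diff 𝔞) hx hy
    have zc : ∀ i, z i ∈ cube N := fun i => (cube_convex N).segment_subset hx hy (hz i)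
    have := tri_upper (m := γ + θ₁) hs hs1 hMpos.le (by linarith)
      (fun i j => dentry (g p 𝔞) (z i) i j) (g p 𝔞 x - g p 𝔞 y) (x - y) hrow
      (fun i j hij => hg.tri 𝔞 _ (zc i) i j hij) (fun i j => gM 𝔞 _ (zc i) i j) (fun i => by
        have b1 := (abs_le.1 (gdiag 𝔞 _ (zc i) i)).2
        have b2 := (gamma_bd hγ hp 𝔞 (zc i)).2
        linarith)
    rw [TW_sub, TW_sub] at this
    refine this.trans ?_
    gcongr
    linarith
  · intro 𝔞 𝔟 q hq x hx y hy z' hz'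
    obtain ⟨z, hz, hrow⟩ := mvt_rows (g p 𝔞) (hg.diff 𝔞) hx hy
    have zc : ∀ i, z i ∈ cube N := fun i => (cube_convex N).segment_subset hx hy (hz i)
    set b := |dentry (S.f p 𝔟) z' ⟨0, hN⟩ ⟨0, hN⟩| with hb
    set t := ‖TW N s x - TW N s z'‖ + ‖TW N s x - TW N s y‖ with ht
    set e := κ1 + K1 * (L * t) + C1 * ϑ ^ q + θ₁ with he
    have hd : ∀ i, max (γ' - θ₁) (b - e) ≤ |dentry (g p 𝔞) (z i) i i| := by
      intro i
      have b1 := (abs_le.1 (gdiag 𝔞 _ (zc i) i)).1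
      have b2 := (gamma_bd hγ hp 𝔞 (zc i)).1
      refine max_le (by linarith) ?_
      have b3 := hmod p hp 𝔟 (z i) (zc i) z' hz'
      have b4 := hh1 p hp' 𝔞 𝔟 q hq (z i) (S.X_subset (zc i))
      have b5 : C1 * ϑ1 ^ q ≤ C1 * ϑ ^ q := mul_le_mul_of_nonneg_left (pow1 q) hC1.le
      have b6 : ‖z i - z'‖ ≤ L * t := by
        refine (norm_le_TW hs hs1 _).trans ?_
        rw [TW_sub]
        have := TW_segment s (z' := z') (hz i)
        gcongr
      have b7 : K1 * ‖z i - z'‖ ≤ K1 * (L * t) := by gcongr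
      have b8 := dentry_sub_le (S.f p 𝔞) (S.f p 𝔟) (z i) (z i) ⟨0, hN⟩ ⟨0, hN⟩
      have b9 := dentry_sub_le (S.f p 𝔟) (S.f p 𝔟) (z i) z' ⟨0, hN⟩ ⟨0, hN⟩
      have c1 := (abs_le.1 (abs_abs_sub_abs_le (dentry (S.f p 𝔞) (z i) ⟨0, hN⟩ ⟨0, hN⟩)
        (dentry (S.f p 𝔟) (z i) ⟨0, hN⟩ ⟨0, hN⟩))).1
      have c2 := (abs_le.1 (abs_abs_sub_abs_le (dentry (S.f p 𝔟) (z i) ⟨0, hN⟩ ⟨0, hN⟩)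
        (dentry (S.f p 𝔟) z' ⟨0, hN⟩ ⟨0, hN⟩))).1
      linarith
    have key := tri_lower hN hs hs1 hMpos.le
      (fun i j => dentry (g p 𝔞) (z i) i j) (g p 𝔞 x - g p 𝔞 y) (x - y) hrow
      (fun i j hij => hg.tri 𝔞 _ (zc i) i j hij) (fun i j => gM 𝔞 _ (zc i) i j) hd
    rw [TW_sub, TW_sub] at key
    set F := max (γ' - θ₁) (b - e) - N * M * s with hF
    have f1 : γ' / 2 ≤ F := by
      have := le_max_left (γ' - θ₁) (b - e)
      linarith
    have f2 : b ≤ F + (e + N * M * s) := by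
      have := le_max_right (γ' - θ₁) (b - e)
      linarith
    have hϑq : 0 < ϑ ^ q := by positivity
    have ht0 : 0 ≤ t := by positivity
    have f3 : e + N * M * s ≤ 3 * κ1 + K2 * (t + ϑ ^ q) := by
      have g1 : 0 ≤ C1 * t := by positivity
      have g2 : 0 ≤ K1 * L * ϑ ^ q := by positivity
      rw [hK2, he]
      nlinarith
    have f4 : 3 * κ1 + K2 * (t + ϑ ^ q) ≤ γ' / 2 * (κ + K * (t + ϑ ^ q)) := by
      have : γ' / 2 * (K * (t + ϑ ^ q)) = K2 * (t + ϑ ^ q) := by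
        rw [hKd]; field_simp
      have e2 : γ' / 2 * (κ + K * (t + ϑ ^ q)) = γ' / 2 * κ + γ' / 2 * (K * (t + ϑ ^ q)) := by ring
      rw [e2, this]
      linarith
    have hW : 0 ≤ κ + K * (t + ϑ ^ q) := by positivity
    have f5 : b ≤ Real.exp (κ + K * (t + ϑ ^ q)) * F := by
      have g1 := Real.add_one_le_exp (κ + K * (t + ϑ ^ q))
      have g2 : γ' / 2 * (κ + K * (t + ϑ ^ q)) ≤ F * (κ + K * (t + ϑ ^ q)) := by gcongr
      have g3 : F * (κ + K * (t + ϑ ^ q) + 1) ≤ F * Real.exp (κ + K * (t + ϑ ^ q)) :=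
        mul_le_mul_of_nonneg_left g1 (by linarith)
      linarith
    calc b * ‖TW N s x - TW N s y‖
        ≤ Real.exp (κ + K * (t + ϑ ^ q)) * F * ‖TW N s x - TW N s y‖ := by gcongr
      _ = Real.exp (κ + K * (t + ϑ ^ q)) * (F * ‖TW N s x - TW N s y‖) := by ring
      _ ≤ _ := by gcongr
  · intro 𝔞 𝔟 q hq x hx
    rw [← TW_sub]
    refine (TW_norm_le hs hs1 _).trans ?_
    have a1 := hg.c0 𝔞 x hx
    have a2 := hh0 p hp' 𝔞 𝔟 q hq x (S.X_subset hx)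
    have a3 := norm_sub_le_norm_sub_add_norm_sub (g p 𝔞 x) (S.f p 𝔞 x) (S.f p 𝔟 x)
    have b5 : C0 * ϑ0 ^ q ≤ C0 * ϑ ^ q := mul_le_mul_of_nonneg_left (pow0 q) hC0.le
    linarith

lemma close_self (hN : 0 < N) (hr : 2 ≤ r) (S : SkewFamily A N d r)
    (hU : UnipOn hN S.f S.P' S.X') {p : E d} (hp : p ∈ closure (cubeO d)) {θ : ℝ} (hθ : 0 < θ) :
    CloseAt S.f S.f p θ := by
  have hp' := S.P_subset hp
  refine ⟨fun 𝔞 x hx => S.into 𝔞 p hp' (mem_image_of_mem _ (S.X_subset hx)), fun 𝔞 x hx =>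
    (partial_hasFDerivAt (F := fun q : E d × E N => S.f q.1 𝔞 q.2)
      (S_diffF hr S.P'_open S.X'_open (S.smooth 𝔞) hp' (S.X_subset hx))).differentiableAt,
    fun 𝔞 x hx => (hU p hp' 𝔞 x (S.X_subset hx)).1, ?_, ?_⟩
  · intro 𝔞 x hx; simpa using hθ.le
  · intro 𝔞 x hx; simpa using hθ.le

lemma close_perturb (hN : 0 < N) (hr : 2 ≤ r) (S : SkewFamily A N d r) {θ : ℝ} {τ : ℕ}
    (Ft : ParamPerturb hN S θ τ) {t : E τ} (ht : t ∈ cubeO τ)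
    {p : E d} (hp : p ∈ closure (cubeO d)) {θ₁ : ℝ} (hθ : θ ≤ θ₁) :
    CloseAt S.f (Ft.g t) p θ₁ := by
  have hp' := S.P_subset hp
  obtain ⟨θ', hθ', hcl⟩ := Ft.close
  have dG : ∀ 𝔞, ∀ x ∈ cube N,
      DifferentiableAt ℝ (fun q : E d × E N => Ft.g t q.1 𝔞 q.2) (p, x) := fun 𝔞 x hx =>
    S_diffF hr S.P'_open S.X'_open (Ft.smooth t ht 𝔞) hp' (S.X_subset hx)
  have dF : ∀ 𝔞, ∀ x ∈ cube N,
      DifferentiableAt ℝ (fun q : E d × E N => S.f q.1 𝔞 q.2) (p, x) := fun 𝔞 x hx =>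
    S_diffF hr S.P'_open S.X'_open (S.smooth 𝔞) hp' (S.X_subset hx)
  refine ⟨fun 𝔞 x hx => Ft.into t ht 𝔞 p hp' (mem_image_of_mem _ (S.X_subset hx)), fun 𝔞 x hx =>
    (partial_hasFDerivAt (dG 𝔞 x hx)).differentiableAt,
    fun 𝔞 x hx => (Ft.unip t ht p hp' 𝔞 x (S.X_subset hx)).1, ?_, ?_⟩
  · intro 𝔞 x hx
    have := hcl t ht 𝔞 0 (by simp) p hp' x (S.X_subset hx)
    rw [norm_iteratedFDeriv_zero] at this
    rw [norm_sub_rev]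
    linarith
  · intro 𝔞 x hx
    have h1 := hcl t ht 𝔞 1 (le_trans (by norm_num) hr) p hp' x (S.X_subset hx)
    rw [norm_iteratedFDeriv_one, fderiv_fun_sub (dF 𝔞 x hx) (dG 𝔞 x hx)] at h1
    have e1 := (partial_hasFDerivAt (dG 𝔞 x hx)).fderiv
    have e2 := (partial_hasFDerivAt (dF 𝔞 x hx)).fderiv
    simp only at e1 e2
    have e3 : (fun y => Ft.g t p 𝔞 y) = Ft.g t p 𝔞 := rfl
    have e4 : (fun y => S.f p 𝔞 y) = S.f p 𝔞 := rfl
    rw [e3] at e1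
    rw [e4] at e2
    rw [e1, e2, norm_sub_rev, ← ContinuousLinearMap.sub_comp]
    refine (ContinuousLinearMap.opNorm_comp_le _ _).trans ?_
    have := inr_norm_le (d := d) (N := N)
    have h0 := norm_nonneg (fderiv ℝ (fun q : E d × E N => S.f q.1 𝔞 q.2) (p, x) -
      fderiv ℝ (fun q : E d × E N => Ft.g t q.1 𝔞 q.2) (p, x))
    have h2 := mul_le_mul_of_nonneg_left this h0
    linarith

lemma lam_bounds {hN : 0 < N} {f : E d → (ℕ → A) → E N → E N} {γ' γ : ℝ}
    (hγ : GammaBounds hN f γ' γ) {p : E d} (hp : p ∈ closure (cubeO d))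
    (h : ∀ 𝔞, ∀ x ∈ cube N, f p 𝔞 x ∈ cube N)
    (hd : ∀ 𝔞, ∀ x ∈ cube N, DifferentiableAt ℝ (f p 𝔞) x)
    (ht : ∀ 𝔞, ∀ x ∈ cube N, ∀ j : Fin N, 0 < (j:ℕ) → dentry (f p 𝔞) x ⟨0, hN⟩ j = 0)
    (w : List A) : ∀ (𝔞 : ℕ → A), ∀ x ∈ cube N,
    γ' ^ w.length ≤ lam hN f p 𝔞 w x ∧ lam hN f p 𝔞 w x ≤ γ ^ w.length := by
  have h0 := hγ.1
  have h01 := hγ.2.1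
  induction w with
  | nil => intro 𝔞 x hx; simp [lam_nil]
  | cons a w ih =>
    intro 𝔞 x hx
    rw [lam_cons hN h hd ht a w 𝔞 hx, List.length_cons, pow_succ', pow_succ']
    obtain ⟨i1, i2⟩ := ih (consF a 𝔞) x hx
    obtain ⟨j1, j2⟩ := gamma_bd hγ hp (consF a 𝔞) (psi_mem h w (consF a 𝔞) x hx)
    exact ⟨mul_le_mul j1.le i1 (by positivity) (abs_nonneg _),
      mul_le_mul j2.le i2 (lam_nonneg _ _ _ _ _ _) (by linarith)⟩

lemma Lam_bounds {hN : 0 < N} {f : E d → (ℕ → A) → E N → E N} {γ' γ : ℝ}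
    (hγ : GammaBounds hN f γ' γ) {p : E d} (hp : p ∈ closure (cubeO d))
    (h : ∀ 𝔞, ∀ x ∈ cube N, f p 𝔞 x ∈ cube N)
    (hd : ∀ 𝔞, ∀ x ∈ cube N, DifferentiableAt ℝ (f p 𝔞) x)
    (ht : ∀ 𝔞, ∀ x ∈ cube N, ∀ j : Fin N, 0 < (j:ℕ) → dentry (f p 𝔞) x ⟨0, hN⟩ j = 0)
    (w : List A) (𝔞 : ℕ → A) :
    0 < Lam hN f p 𝔞 w ∧ Lam hN f p 𝔞 w ≤ γ ^ w.length := by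
  have hb := lam_bounds hγ hp h hd ht w 𝔞
  have h0 := hγ.1
  constructor
  · refine lt_of_lt_of_le (pow_pos h0 w.length) ((hb 0 (zero_mem_cube N)).1.trans ?_)
    refine le_csSup ⟨γ ^ w.length, ?_⟩ (mem_image_of_mem _ (zero_mem_cube N))
    rintro _ ⟨z, hz, rfl⟩
    exact (hb z hz).2
  · refine csSup_le ⟨_, mem_image_of_mem _ (zero_mem_cube N)⟩ ?_
    rintro _ ⟨z, hz, rfl⟩
    exact (hb z hz).2

lemma numeric {N : ℕ} (hN : 0 < N) {γ ε η κ Λ rr R D₂ C : ℝ} {n : ℕ} (hγ0 : 0 < γ) (hγ1 : γ < 1)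
    (hε : 0 < ε) (hη : η = -ε * Real.log γ / (2 * N + ε)) (hκ : κ = ε * (-Real.log γ) / (12 * N))
    (hΛ : 0 < Λ) (hΛγ : Λ ≤ γ ^ n) (hrr : 0 < rr) (hR : 0 < R) (hD : 0 < D₂) (hC : 0 < C) :
    C * (R * D₂ * Real.exp ((η + 2 * κ) * n) * Λ⁻¹ * rr) ^ N ≤
      C * (R * D₂) ^ N * rr ^ N * Λ ^ (-(N : ℝ) - 2 * ε / 3) := by
  have hNpos : (0:ℝ) < N := by exact_mod_cast hN
  set l := -Real.log γ with hl
  have hlpos : 0 < l := by have := Real.log_neg hγ0 hγ1; linarith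
  have h1 : N * η ≤ ε * l / 2 := by
    rw [hη, ← mul_div_assoc, div_le_div_iff₀ (by positivity) (by norm_num)]
    have : 0 ≤ ε * l * ε := by positivity
    have e : -ε * Real.log γ = ε * l := by rw [hl]; ring
    rw [e]; nlinarith
  have h2 : N * κ = ε * l / 12 := by rw [hκ]; field_simp
  have h3 : N * (η + 2 * κ) ≤ 2 * ε / 3 * l := by nlinarith
  have hlog : Real.log Λ ≤ n * Real.log γ := by
    rw [← Real.log_pow]; exact Real.log_le_log hΛ hΛγ
  have h4 : Real.exp ((η + 2 * κ) * n) ^ N ≤ Λ ^ (-(2 * ε / 3)) := by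
    rw [← Real.exp_nat_mul, Real.rpow_def_of_pos hΛ]
    apply Real.exp_le_exp.2
    have a1 : (N * (η + 2 * κ)) * n ≤ (2 * ε / 3 * l) * n := by gcongr
    have a2 : (2 * ε / 3) * Real.log Λ ≤ (2 * ε / 3) * (n * Real.log γ) := by gcongr
    rw [hl] at a1
    nlinarith
  have h5 : Λ ^ (-(N : ℝ) - 2 * ε / 3) = Λ⁻¹ ^ N * Λ ^ (-(2 * ε / 3)) := by
    rw [sub_eq_add_neg, Real.rpow_add hΛ, Real.rpow_neg hΛ.le, Real.rpow_natCast, inv_pow]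
  rw [h5]
  calc _ = C * (R * D₂) ^ N * rr ^ N * (Λ⁻¹ ^ N * Real.exp ((η + 2 * κ) * n) ^ N) := by
        rw [mul_pow, mul_pow, mul_pow]; ring
    _ ≤ _ := by gcongr

end final

/-- Lemma: transversality estimate localized to a small ball of parameters. -/
theorem lemma_bornelilou {A : Type} [Fintype A] {N d : ℕ} {r : ℕ∞}
    (hA : 2 ≤ Fintype.card A) (hN : 0 < N) (hd : 0 < d) (hr : 2 ≤ r)
    (S : SkewFamily A N d r)
    (hU : UnipOn hN S.f S.P' S.X')
    (γ' γ : ℝ) (hγ : GammaBounds hN S.f γ' γ)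
    (hT : TransAssumption hN S)
    (Δ : E d → ℝ)
    (hΔzero : ∀ p ∈ closure (cubeO d), 0 ≤ Δ p ∧ ∀ 𝔞 : ℕ → A, pressure S.f p 𝔞 (Δ p) = 0)
    (hΔ : ∀ p ∈ closure (cubeO d), (N : ℝ) < Δ p)
    (ε η : ℝ)
    (hε : ε = (sInf (Δ '' closure (cubeO d)) - N) / 2) (hεpos : 0 < ε)
    (hη : η = -ε * Real.log γ / (2 * N + ε))
    (p₀ : E d) (hp₀ : p₀ ∈ cubeO d) (𝔞₀ : ℕ → A)
    (δ : ℝ) (hδ : 0 < δ) (hball : Metric.ball p₀ δ ⊆ cubeO d)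
    (D₂ : ℝ) (hD₂ : 1 < D₂)
    (hdist : ∀ p₁ ∈ closure (cubeO d), ∀ p₂ ∈ closure (cubeO d), ‖p₁ - p₂‖ ≤ δ →
      ∀ (𝔞 : ℕ → A) (w : List A),
        D₂⁻¹ * Real.exp (-η * w.length) < Lam hN S.f p₁ 𝔞 w / Lam hN S.f p₂ 𝔞 w ∧
        Lam hN S.f p₁ 𝔞 w / Lam hN S.f p₂ 𝔞 w < D₂ * Real.exp (η * w.length)) :
    ∃ C' > (0:ℝ),
      (∀ (𝔞 : ℕ → A) (w : List A) (α β : ℕ → A),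
        (∀ i : Fin w.length, α i = w.get i) → (∀ i : Fin w.length, β i = w.get i) →
        α w.length ≠ β w.length → ∀ rr > (0:ℝ),
        volume {p ∈ Metric.ball p₀ δ | ‖piProj S.f p 𝔞 α - piProj S.f p 𝔞 β‖ < rr}
          ≤ ENNReal.ofReal
              (C' * rr ^ N * Lam hN S.f p₀ 𝔞₀ w ^ (-(N : ℝ) - 2 * ε / 3))) ∧
      ∃ θ₀ > (0:ℝ), ∀ τ : ℕ, 0 < τ → ∀ Ft : ParamPerturb hN S θ₀ τ, ∀ t ∈ cubeO τ,
        ∀ (𝔞 : ℕ → A) (w : List A) (α β : ℕ → A),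
        (∀ i : Fin w.length, α i = w.get i) → (∀ i : Fin w.length, β i = w.get i) →
        α w.length ≠ β w.length → ∀ rr > (0:ℝ),
        volume {p ∈ Metric.ball p₀ δ |
            ‖piProj (Ft.g t) p 𝔞 α - piProj (Ft.g t) p 𝔞 β‖ < rr}
          ≤ ENNReal.ofReal
              (C' * rr ^ N * Lam hN S.f p₀ 𝔞₀ w ^ (-(N : ℝ) - 2 * ε / 3)) := by
  have hne : Nonempty A := Fintype.card_pos_iff.1 (by omega)
  have hNpos : (0:ℝ) < N := by exact_mod_cast hN
  have hγ0 : 0 < γ := hγ.1.trans hγ.2.1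
  have hγ1 : γ < 1 := hγ.2.2.1
  have hlog : 0 < -Real.log γ := by have := Real.log_neg hγ0 hγ1; linarith
  obtain ⟨κ, hκdef⟩ : ∃ κ : ℝ, κ = ε * (-Real.log γ) / (12 * N) := ⟨_, rfl⟩
  have hκ : 0 < κ := by rw [hκdef]; positivity
  obtain ⟨s, γ₂, K, C, ϑ, θ₁, hs, hs1, hγ₂0, hγ₂1, hK, hC, hϑ0, hϑ1, hθ₁, hKθ, hgood⟩ :=
    good_exists hN hr S hU hγ hκ
  obtain ⟨CT, hCT, hT1, θ₀, hθ₀, hT2⟩ := hT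
  set R := N * (s ^ N)⁻¹ *
    Real.exp (K * (4 * (1 - γ₂)⁻¹ + (1 + (1 - γ₂)⁻¹ * C) * ϑ / (1 - ϑ))) with hRdef
  have hR : 0 < R := by positivity
  have hD : 0 < D₂ := by linarith
  have hp₀c : p₀ ∈ closure (cubeO d) := subset_closure hp₀
  have G₀ := hgood S.f p₀ hp₀c (close_self hN hr S hU hp₀c hθ₁)
  have claim : ∀ g : E d → (ℕ → A) → E N → E N,
      (∀ p ∈ closure (cubeO d), CloseAt S.f g p θ₁) →
      (∀ 𝔞 α β : ℕ → A, α 0 ≠ β 0 → ∀ rr > (0:ℝ),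
        volume {p ∈ cubeO d | ‖piProj g p 𝔞 α - piProj g p 𝔞 β‖ < rr}
          ≤ ENNReal.ofReal (CT * rr ^ N)) →
      ∀ (𝔞 : ℕ → A) (w : List A) (α β : ℕ → A),
        (∀ i : Fin w.length, α i = w.get i) → (∀ i : Fin w.length, β i = w.get i) →
        α w.length ≠ β w.length → ∀ rr > (0:ℝ),
        volume {p ∈ Metric.ball p₀ δ | ‖piProj g p 𝔞 α - piProj g p 𝔞 β‖ < rr}
          ≤ ENNReal.ofReal
              (CT * (R * D₂) ^ N * rr ^ N * Lam hN S.f p₀ 𝔞₀ w ^ (-(N : ℝ) - 2 * ε / 3)) := by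
    intro g hg hTg 𝔞 w α β hα hβ hne' rr hrr
    obtain ⟨hΛ, hΛγ⟩ := Lam_bounds hγ hp₀c G₀.intoF G₀.diffF G₀.tri w 𝔞₀
    set Λ := Lam hN S.f p₀ 𝔞₀ w with hΛdef
    have hrr' : 0 < R * D₂ * Real.exp ((η + 2 * κ) * w.length) * Λ⁻¹ * rr := by positivity
    have hT' := hTg (app w 𝔞) (fun k => α (w.length + k)) (fun k => β (w.length + k)) hne' _ hrr'
    refine (measure_mono ?_).trans (hT'.trans (ENNReal.ofReal_le_ofReal
      (numeric hN hγ0 hγ1 hεpos hη hκdef hΛ hΛγ hrr hR hD hCT)))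
    rintro p ⟨hpb, hpr⟩
    have hpO := hball hpb
    have hpc : p ∈ closure (cubeO d) := subset_closure hpO
    refine ⟨hpO, ?_⟩
    have G := hgood g p hpc (hg p hpc)
    rw [pi_shift hs hs1 hγ₂0 hγ₂1 G 𝔞 α w hα, pi_shift hs hs1 hγ₂0 hγ₂1 G 𝔞 β w hβ] at hpr
    have hx := pi_mem hs hs1 hγ₂0 hγ₂1 G (app w 𝔞) (fun k => α (w.length + k))
    have hy := pi_mem hs hs1 hγ₂0 hγ₂1 G (app w 𝔞) (fun k => β (w.length + k))
    set x := piProj g p (app w 𝔞) (fun k => α (w.length + k)) with hxdef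
    set y := piProj g p (app w 𝔞) (fun k => β (w.length + k)) with hydef
    have hb := exp_bound hs hs1 hγ₂0 hγ₂1 hϑ0 hϑ1 hC hK G w 𝔞 𝔞₀ hx hy
    have hdd := (hdist p hpc p₀ hp₀c (by
      have := Metric.mem_ball.1 hpb
      rw [dist_eq_norm] at this
      exact this.le) 𝔞₀ w).1
    rw [lt_div_iff₀ hΛ] at hdd
    have hn : (0:ℝ) ≤ w.length := Nat.cast_nonneg _
    have he : Real.exp ((κ + K * (1 - γ₂)⁻¹ * θ₁) * w.length) ≤
        Real.exp (2 * κ * w.length) := by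
      apply Real.exp_le_exp.2
      apply mul_le_mul_of_nonneg_right _ hn
      linarith
    have h1 : D₂⁻¹ * Real.exp (-η * w.length) * Λ * ‖x - y‖ <
        R * Real.exp (2 * κ * w.length) * rr := by
      calc D₂⁻¹ * Real.exp (-η * w.length) * Λ * ‖x - y‖
          ≤ Lam hN S.f p 𝔞₀ w * ‖x - y‖ := mul_le_mul_of_nonneg_right hdd.le (norm_nonneg _)
        _ ≤ _ := hb
        _ = R * Real.exp ((κ + K * (1 - γ₂)⁻¹ * θ₁) * w.length) *
              ‖psi g p w 𝔞 x - psi g p w 𝔞 y‖ := by rw [hRdef]; ring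
        _ ≤ R * Real.exp (2 * κ * w.length) * ‖psi g p w 𝔞 x - psi g p w 𝔞 y‖ :=
            mul_le_mul_of_nonneg_right (mul_le_mul_of_nonneg_left he hR.le) (norm_nonneg _)
        _ < _ := mul_lt_mul_of_pos_left hpr (by positivity)
    have hQ : 0 < D₂ * Real.exp (η * w.length) * Λ⁻¹ := by positivity
    have h2 := mul_lt_mul_of_pos_left h1 hQ
    have e1 : D₂ * Real.exp (η * w.length) * Λ⁻¹ *
        (D₂⁻¹ * Real.exp (-η * w.length) * Λ * ‖x - y‖) = ‖x - y‖ := by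
      have : Real.exp (η * w.length) * Real.exp (-η * w.length) = 1 := by
        rw [← Real.exp_add]; simp
      calc _ = (D₂ * D₂⁻¹) * (Real.exp (η * w.length) * Real.exp (-η * w.length)) *
            (Λ⁻¹ * Λ) * ‖x - y‖ := by ring
        _ = _ := by rw [this, mul_inv_cancel₀ hD.ne', inv_mul_cancel₀ hΛ.ne']; ring
    have e2 : D₂ * Real.exp (η * w.length) * Λ⁻¹ * (R * Real.exp (2 * κ * w.length) * rr) =
        R * D₂ * Real.exp ((η + 2 * κ) * w.length) * Λ⁻¹ * rr := by
      rw [add_mul, Real.exp_add]; ring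
    rw [e1, e2] at h2
    exact h2
  refine ⟨CT * (R * D₂) ^ N, by positivity,
    claim S.f (fun p hp => close_self hN hr S hU hp hθ₁) hT1,
    min θ₀ θ₁, lt_min hθ₀ hθ₁, fun τ hτ Ft t ht => ?_⟩
  exact claim (Ft.g t) (fun p hp => close_perturb hN hr S Ft ht hp (min_le_right _ _))
    (hT2 _ (lt_min hθ₀ hθ₁) (min_le_left _ _) τ hτ Ft t ht)

end Paper
end
end
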